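/- arXiv:1809.09811 — 2 statements merged into one kernel-verified Lean document; each statement's English description precedes it below -/
import Mathlib

section
/- Let p and n be primes with n > 13 such that p is a primitive root modulo n (the multiplicative order of p modulo n equals n − 1), and let L = PSL_n(p). Then the compact form S_c(L) of the solvable graph of L is not a split graph. -/
/-- A split partition of the graph `Γ` with vertex set `S`: a partition of `S`
into a clique `C` and an independent set `I`. -/
def SimpleGraph.IsSplitPartition {V : Type*} (Γ : SimpleGraph V) (S C I : Set V) : Prop :=
  C ∪ I = S ∧ Disjoint C I ∧ Γ.IsClique C ∧ I.Pairwise fun u v => ¬ Γ.Adj u v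

/-- `Γ` (with vertex set `S`) is a split graph: `S` can be partitioned into a
clique and an independent set. -/
def SimpleGraph.IsSplit {V : Type*} (Γ : SimpleGraph V) (S : Set V) : Prop :=
  ∃ C I : Set V, Γ.IsSplitPartition S C I

/-- The closed neighborhood of a vertex. -/
def closedNbhd {V : Type*} (Γ : SimpleGraph V) (v : V) : Set V := insert v (Γ.neighborSet v)

/-- Vertices are equivalent iff they have the same closed neighborhood. -/
def nbhdSetoid {V : Type*} (Γ : SimpleGraph V) : Setoid V where
  r u v := closedNbhd Γ u = closedNbhd Γ v
  iseqv := ⟨fun _ => rfl, Eq.symm, Eq.trans⟩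

/-- The compact form of `Γ`: the quotient of `Γ` by equality of closed
neighborhoods; two distinct classes are adjacent iff some representatives are. -/
def compactForm {V : Type*} (Γ : SimpleGraph V) :
    SimpleGraph (Quotient (nbhdSetoid Γ)) where
  Adj a b := a ≠ b ∧ ∃ u v : V,
    Quotient.mk (nbhdSetoid Γ) u = a ∧ Quotient.mk (nbhdSetoid Γ) v = b ∧ Γ.Adj u v
  symm := by
    constructor
    rintro a b ⟨hne, u, v, hu, hv, huv⟩
    exact ⟨hne.symm, v, u, hv, hu, huv.symm⟩
  loopless := by constructor; rintro a ⟨hne, _⟩; exact hne rfl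

/-- The solvable graph of a finite group `G` on its genuine vertex set: the
primes dividing the order of `G`; two distinct primes are adjacent iff `G` has
a solvable subgroup of order divisible by their product. -/
def solvableGraphOn (G : Type*) [Group G] :
    SimpleGraph {r : ℕ // r.Prime ∧ r ∣ Nat.card G} where
  Adj r s := r ≠ s ∧ ∃ H : Subgroup G, IsSolvable H ∧ r.val * s.val ∣ Nat.card H
  symm := by
    constructor
    rintro r s ⟨hne, H, hH, hdvd⟩
    exact ⟨hne.symm, H, hH, by rwa [Nat.mul_comm] at hdvd⟩
  loopless := by constructor; rintro r ⟨hne, _⟩; exact hne rfl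

section PrimitivePrimeDivisors

open Polynomial

theorem sq_prime_not_dvd_geom_sum {q : ℕ} (hq : q.Prime) {y : ℤ} (hy : (q : ℤ) ∣ y - 1)
    (h : q ≠ 2 ∨ 4 ∣ y - 1) : ¬ (q : ℤ) ^ 2 ∣ ∑ k ∈ Finset.range q, y ^ k := by
  intro hd
  rcases eq_or_ne q 2 with rfl | h2
  · have h4 : (4 : ℤ) ∣ y - 1 := h.resolve_left (by simp)
    norm_num [Finset.sum_range_succ] at hd
    omega
  · obtain ⟨b, hb⟩ := hy
    have key := odd_sq_dvd_geom_sum₂_sub (1 : ℤ) b (hq.odd_of_ne_two h2)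
    rw [← hb] at key
    simp only [add_sub_cancel, one_pow, mul_one] at key
    have h3 : (q : ℤ) ^ 2 ∣ q := by simpa using dvd_sub hd key
    have h4 : q ^ 2 ∣ q := by exact_mod_cast h3
    have := Nat.le_of_dvd hq.pos h4
    nlinarith [hq.two_le]

theorem orderOf_eq_of_prime_dvd_cyclotomic_eval {q a t p : ℕ} (hq : q.Prime) (ht : ¬ q ∣ t)
    (hd : (q : ℤ) ∣ (cyclotomic (q ^ a * t) ℤ).eval (p : ℤ)) : orderOf (p : ZMod q) = t := by
  have := Fact.mk hq
  have : NeZero (t : ZMod q) := ⟨by rwa [Ne, ZMod.natCast_eq_zero_iff]⟩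
  have hroot : (cyclotomic (q ^ a * t) (ZMod q)).IsRoot (p : ZMod q) := by
    rw [← map_cyclotomic_int, IsRoot.def]
    have := (ZMod.intCast_zmod_eq_zero_iff_dvd _ q).2 hd
    have h2 := eval_intCast_map (Int.castRingHom (ZMod q)) (cyclotomic (q ^ a * t) ℤ) (p : ℤ)
    simp only [Int.cast_natCast, eq_intCast] at h2
    rw [h2, this]
  exact ((isRoot_cyclotomic_prime_pow_mul_iff_of_charP).1 hroot).eq_orderOf.symm

theorem expand_cyclotomic_mul_prime {q : ℕ} (hq : q.Prime) (t a : ℕ) :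
    expand ℤ (q ^ a) (cyclotomic (t * q) ℤ) = cyclotomic (q ^ (a + 1) * t) ℤ := by
  induction a with
  | zero => simp [mul_comm]
  | succ a ih =>
    rw [pow_succ', expand_mul, ih,
      cyclotomic_expand_eq_cyclotomic hq (Dvd.intro (q ^ a * t) (by ring))]
    congr 1; ring

theorem cyclotomic_eval_mul_ge {q : ℕ} (hq : q.Prime) {t : ℕ} (ht : ¬ q ∣ t) (a : ℕ) {p : ℕ}
    (hp : 2 ≤ p) :
    (((p ^ q ^ a : ℕ) : ℝ) ^ q - 1) ^ t.totient ≤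
      (((cyclotomic (q ^ (a + 1) * t) ℤ).eval (p : ℤ) : ℤ) : ℝ) *
        (((p ^ q ^ a : ℕ) : ℝ) + 1) ^ t.totient := by
  set b : ℕ := p ^ q ^ a with hb
  have hb2 : 1 < b := Nat.one_lt_pow (pow_ne_zero _ hq.ne_zero) (by omega)
  have hb1 : (1 : ℝ) < b := by exact_mod_cast hb2
  have hcast (k : ℕ) (x : ℤ) :
      (((cyclotomic k ℤ).eval x : ℤ) : ℝ) = (cyclotomic k ℝ).eval (x : ℝ) := by
    rw [← map_cyclotomic_int k ℝ, eval_intCast_map]; simp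
  have h1 : (((cyclotomic (q ^ (a + 1) * t) ℤ).eval (p : ℤ) : ℤ) : ℝ) =
      (cyclotomic (t * q) ℝ).eval (b : ℝ) := by
    rw [← expand_cyclotomic_mul_prime hq, expand_eval, hcast]
    simp [hb]
  have h2 := congrArg (eval (b : ℝ)) (cyclotomic_expand_eq_cyclotomic_mul hq ht ℝ)
  rw [expand_eval, eval_mul] at h2
  rw [h1]
  calc ((b : ℝ) ^ q - 1) ^ t.totient ≤ (cyclotomic t ℝ).eval ((b : ℝ) ^ q) :=
        sub_one_pow_totient_le_cyclotomic_eval (one_lt_pow₀ hb1 hq.ne_zero) t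
    _ = _ := h2
    _ ≤ _ := by
        refine mul_le_mul_of_nonneg_left (cyclotomic_eval_le_add_one_pow_totient hb1 t) ?_
        exact cyclotomic_nonneg _ hb1.le

theorem mul_add_one_lt_pow_sub_one {q b : ℕ} (hb : 2 ≤ b) (h3 : 3 ≤ q)
    (h : 3 < q ∨ 3 ≤ b) : q * (b + 1) + 1 < b ^ q := by
  have base : ∀ k m : ℕ, k * (b + 1) + 1 < b ^ k → 1 ≤ k → (k + m) * (b + 1) + 1 < b ^ (k + m) := by
    intro k m hk hk1
    induction m with
    | zero => simpa using hk
    | succ m ih =>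
      rw [← add_assoc, pow_succ]
      have h1 : b ^ (k + m) * 2 ≤ b ^ (k + m) * b := Nat.mul_le_mul_left _ hb
      have h2 : 1 * (b + 1) ≤ (k + m) * (b + 1) := Nat.mul_le_mul_right _ (by omega)
      linarith [add_mul (k + m) 1 (b + 1)]
  obtain h | h := h
  · obtain ⟨m, rfl⟩ := Nat.exists_eq_add_of_le h
    refine base 4 m ?_ (by norm_num)
    nlinarith [sq_nonneg (b ^ 2), mul_le_mul hb hb (by omega) (by omega),
      pow_le_pow_left₀ (by omega) hb 3]
  · obtain ⟨m, rfl⟩ := Nat.exists_eq_add_of_le h3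
    exact base 3 m (by nlinarith [mul_le_mul h h (by omega) (by omega)]) (by norm_num)

/-- Existence of primitive prime divisors (Zsigmondy's theorem for `a ^ i - 1`, `i ≥ 6`). -/
theorem exists_prime_orderOf_eq {p i : ℕ} (hp : 2 ≤ p) (hi : 6 ≤ i) (hpi : ¬ (p = 2 ∧ i = 6)) :
    ∃ q : ℕ, q.Prime ∧ orderOf (p : ZMod q) = i := by
  by_contra! hcon
  set Φ : ℤ := (cyclotomic i ℤ).eval (p : ℤ) with hΦ
  have hbad : ∀ q : ℕ, q.Prime → (q : ℤ) ∣ Φ → q ∣ i := by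
    intro q hq hd
    by_contra hqi
    exact hcon q hq (orderOf_eq_of_prime_dvd_cyclotomic_eval (a := 0) hq hqi (by simpa using hd))
  have hΦ1 : 1 < Φ.natAbs := by
    have := sub_one_lt_natAbs_cyclotomic_eval (n := i) (q := p) (by omega) (by omega)
    rw [← hΦ] at this
    omega
  have hΦpos : 0 < Φ := cyclotomic_pos (by omega) _
  obtain ⟨q, hq, hqΦ⟩ := Nat.exists_prime_and_dvd hΦ1.ne'
  have hqd : (q : ℤ) ∣ Φ := Int.natCast_dvd.2 hqΦ
  have hqi := hbad q hq hqd
  have := Fact.mk hq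
  obtain ⟨a, t, ht, hit⟩ := Nat.exists_eq_pow_mul_and_not_dvd (n := i) (by omega) q hq.ne_one
  obtain ⟨a, rfl⟩ : ∃ c, a = c + 1 := by
    refine Nat.exists_eq_succ_of_ne_zero ?_
    rintro rfl
    exact ht (by simpa [hit] using hqi)
  have ht0 : t ≠ 0 := by rintro rfl; simp at ht
  have hordt : orderOf (p : ZMod q) = t :=
    orderOf_eq_of_prime_dvd_cyclotomic_eval hq ht (by rw [← hit]; exact hqd)
  have hp0 : (p : ZMod q) ≠ 0 := by
    intro h0
    rw [h0, orderOf_zero] at hordt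
    exact ht0 hordt.symm
  have htq : t ∣ q - 1 := hordt ▸ ZMod.orderOf_dvd_card_sub_one hp0
  have htlt : t < q := by
    have := Nat.le_of_dvd (by have := hq.two_le; omega) htq
    have := hq.two_le
    omega
  -- `q` is the only prime divisor of `Φ`
  have huniq : ∀ {d : ℕ}, d.Prime → d ∣ Φ.natAbs → d = q := by
    intro d hd hdΦ
    by_contra hne
    have hdi := hbad d hd (Int.natCast_dvd.2 hdΦ)
    have hdt : d ∣ t := by
      rw [hit] at hdi
      refine (Nat.Coprime.dvd_of_dvd_mul_left ?_ hdi)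
      exact Nat.Coprime.pow_right _ ((Nat.coprime_primes hd hq).2 hne)
    obtain ⟨c, u, hu, hiu⟩ := Nat.exists_eq_pow_mul_and_not_dvd (n := i) (by omega) d hd.ne_one
    have hu0 : u ≠ 0 := by rintro rfl; simp at hu
    have hordu : orderOf (p : ZMod d) = u :=
      orderOf_eq_of_prime_dvd_cyclotomic_eval (a := c) hd hu
        (by rw [← hiu]; exact Int.natCast_dvd.2 hdΦ)
    have := Fact.mk hd
    have hp0' : (p : ZMod d) ≠ 0 := by
      intro h0
      rw [h0, orderOf_zero] at hordu
      exact hu0 hordu.symm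
    have hud : u ∣ d - 1 := hordu ▸ ZMod.orderOf_dvd_card_sub_one hp0'
    have hqu : q ∣ u := by
      rw [hiu] at hqi
      refine (Nat.Coprime.dvd_of_dvd_mul_left ?_ hqi)
      exact Nat.Coprime.pow_right _ ((Nat.coprime_primes hq hd).2 (Ne.symm hne))
    have h1 := Nat.le_of_dvd (by have := hd.two_le; omega) (hqu.trans hud)
    have h2 := Nat.le_of_dvd (by omega) hdt
    have := hd.two_le
    omega
  have hpow := Nat.eq_prime_pow_of_unique_prime_dvd (by omega) huniq
  -- `q ^ 2` does not divide `Φ`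
  have hi' : i = q ^ a * t * q := by rw [hit]; ring
  have hsq : ¬ (q : ℤ) ^ 2 ∣ Φ := by
    have hy1 : (q : ℤ) ∣ (p : ℤ) ^ (q ^ a * t) - 1 := by
      rw [← ZMod.intCast_zmod_eq_zero_iff_dvd]
      push_cast
      rw [mul_comm, pow_mul, ← hordt, pow_orderOf_eq_one, one_pow, sub_self]
    intro hd
    refine sq_prime_not_dvd_geom_sum hq hy1 ?_ (hd.trans ?_)
    · by_cases hq2 : q = 2
      · right
        subst hq2
        have ht1 : t = 1 := by omega
        subst ht1
        have ha : a ≠ 0 := by rintro rfl; simp at hit; omega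
        obtain ⟨c, rfl⟩ := Nat.exists_eq_succ_of_ne_zero ha
        have hodd : Odd (p : ℤ) := by
          rw [Int.odd_coe_nat]
          by_contra hev
          rw [Nat.not_odd_iff_even, even_iff_two_dvd, ← ZMod.natCast_eq_zero_iff] at hev
          exact hp0 hev
        have h4 := Int.sq_mod_four_eq_one_of_odd (hodd.pow (n := 2 ^ c))
        rw [← pow_mul, ← pow_succ] at h4
        rw [mul_one, Nat.succ_eq_add_one]
        omega
      · exact Or.inl hq2
    · have hpd : q ^ a * t ∈ i.properDivisors := by
        rw [Nat.mem_properDivisors]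
        refine ⟨⟨q, hi'⟩, ?_⟩
        rw [hi']
        have : 0 < q ^ a * t := Nat.mul_pos (pow_pos hq.pos _) (Nat.pos_of_ne_zero ht0)
        nlinarith [hq.two_le]
      have h := eval_dvd (x := (p : ℤ)) (X_pow_sub_one_mul_cyclotomic_dvd_X_pow_sub_one_of_dvd ℤ hpd)
      simp only [eval_mul, eval_sub, eval_pow, eval_X, eval_one] at h
      have hg := mul_geom_sum ((p : ℤ) ^ (q ^ a * t)) q
      rw [← pow_mul, ← hi'] at hg
      rw [← hg] at h
      refine (mul_dvd_mul_iff_left ?_).1 h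
      have : (1 : ℤ) < (p : ℤ) ^ (q ^ a * t) := by
        refine one_lt_pow₀ (by exact_mod_cast hp) ?_
        exact Nat.mul_ne_zero (pow_ne_zero _ hq.ne_zero) ht0
      omega
  have hΦq : Φ = q := by
    have hΦabs : Φ = (Φ.natAbs : ℤ) := by omega
    generalize Φ.natAbs.primeFactorsList.length = l at hpow
    rw [hpow] at hΦabs hΦ1
    match l with
    | 0 => simp at hΦ1
    | 1 => simpa using hΦabs
    | l + 2 => exact absurd (hΦabs ▸ ⟨(q : ℤ) ^ l, by push_cast; ring⟩) hsq
  -- size estimate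
  have hest := cyclotomic_eval_mul_ge hq ht a hp
  rw [← hit, ← hΦ, hΦq] at hest
  set b : ℕ := p ^ q ^ a with hb
  have hb2 : 2 ≤ b := hp.trans (Nat.le_self_pow (pow_ne_zero _ hq.ne_zero) p)
  have hφ : t.totient ≠ 0 := (Nat.totient_pos.2 (Nat.pos_of_ne_zero ht0)).ne'
  have hle : (b : ℝ) ^ q - 1 ≤ q * (b + 1) := by
    have hq1 : (1 : ℝ) ≤ q := by exact_mod_cast hq.one_le
    have h0 : (0 : ℝ) ≤ q * (b + 1) := by positivity
    refine le_of_pow_le_pow_left₀ hφ h0 (hest.trans ?_)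
    rw [mul_pow]
    push_cast
    gcongr
    exact le_self_pow₀ hq1 hφ
  have hle' : b ^ q ≤ q * (b + 1) + 1 := by
    have : (b : ℝ) ^ q ≤ q * (b + 1) + 1 := by linarith
    exact_mod_cast this
  rcases hq.eq_two_or_odd' with rfl | hodd
  · have ht1 : t = 1 := by omega
    subst ht1
    have ha : 2 ≤ a := by
      by_contra! h
      interval_cases a <;> omega
    have : 16 ≤ b := by
      calc 16 = 2 ^ 2 ^ 2 := by norm_num
        _ ≤ p ^ 2 ^ 2 := Nat.pow_le_pow_left hp _
        _ ≤ b := Nat.pow_le_pow_right (by omega) (Nat.pow_le_pow_right (by norm_num) ha)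
    nlinarith
  · have h3 : 3 ≤ q := by
      have := hq.two_le
      obtain ⟨c, hc⟩ := hodd
      omega
    refine absurd hle' (not_le.2 (mul_add_one_lt_pow_sub_one hb2 h3 ?_))
    by_contra! hsmall
    have hq3 : q = 3 := by omega
    have hbeq : b = 2 := by omega
    subst hq3
    have hp2 : p = 2 := by
      have : p ≤ b := Nat.le_self_pow (pow_ne_zero _ (by norm_num)) p
      omega
    have ha : a = 0 := by
      by_contra ha
      have h1 : 3 ≤ 3 ^ a := Nat.le_self_pow ha 3
      have h2 : 2 ^ 3 ≤ b := by
        rw [hb, hp2]; exact Nat.pow_le_pow_right (by norm_num) h1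
      omega
    subst ha
    exact hpi ⟨hp2, by omega⟩

end PrimitivePrimeDivisors

theorem exists_normal_pGroup {H : Type*} [Group H] [Finite H] [Group.IsSolvable H] [Nontrivial H] :
    ∃ (q : ℕ) (M : Subgroup H), q.Prime ∧ M.Normal ∧ IsPGroup q M ∧ M ≠ ⊥ := by
  classical
  obtain ⟨A, hAn, hA, hAc⟩ : ∃ A : Subgroup H, A.Normal ∧ A ≠ ⊥ ∧ ⁅A, A⁆ = ⊥ := by
    have hs := (Group.isSolvable_def H).1 inferInstance
    have h0 : Nat.find hs ≠ 0 := by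
      intro h
      have := Nat.find_spec hs
      rw [h, derivedSeries_zero] at this
      exact top_ne_bot this
    obtain ⟨k, hk⟩ := Nat.exists_eq_succ_of_ne_zero h0
    refine ⟨derivedSeries H k, inferInstance, Nat.find_min hs (by omega), ?_⟩
    rw [← derivedSeries_succ, ← Nat.succ_eq_add_one, ← hk]
    exact Nat.find_spec hs
  have hcard : Nat.card A ≠ 1 := by rwa [Ne, Subgroup.card_eq_one]
  obtain ⟨q, hq, hqA⟩ := Nat.exists_prime_and_dvd hcard
  have := Fact.mk hq
  have hcomm : ∀ a b : A, a * b = b * a := by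
    intro a b
    have := Subgroup.commutator_eq_bot_iff_le_centralizer.1 hAc a.2
    exact Subtype.ext ((Subgroup.mem_centralizer_iff.1 this b b.2).symm)
  let P : Sylow q A := default
  have hPn : (P : Subgroup A).Normal := ⟨fun x hx g => by rwa [hcomm g x, mul_inv_cancel_right]⟩
  have := P.characteristic_of_normal hPn
  refine ⟨q, (P : Subgroup A).map A.subtype, hq, inferInstance, P.2.map _, ?_⟩
  rw [Ne, Subgroup.map_eq_bot_iff_of_injective _ A.subtype_injective]
  exact P.ne_bot_of_dvd_card hqA

theorem exists_pGroup_dvd_card_normalizer_of_quotient {H : Type*} [Group H] [Finite H]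
    {q r s : ℕ} (hr : r.Prime) (hs : s.Prime) (hq : q.Prime) (hqs : q ≠ s)
    (M : Subgroup H) [M.Normal] (hM : IsPGroup q M) (hrs : r ≠ s)
    (R : Subgroup (H ⧸ M)) (hR : IsPGroup r R) (hR1 : R ≠ ⊥)
    (hd : s ∣ Nat.card (Subgroup.normalizer (R : Set (H ⧸ M)))) :
    ∃ R' : Subgroup H, IsPGroup r R' ∧ R' ≠ ⊥ ∧
      s ∣ Nat.card (Subgroup.normalizer (R' : Set H)) := by
  have := Fact.mk hr
  have := Fact.mk hs
  have := Fact.mk hq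
  obtain ⟨e, he⟩ := IsPGroup.iff_card.1 hM
  obtain ⟨f, hf⟩ := IsPGroup.iff_card.1 hR
  have hf0 : f ≠ 0 := by
    rintro rfl
    exact hR1 (Subgroup.card_eq_one.1 (by simpa using hf))
  have hcomap (T : Subgroup (H ⧸ M)) :
      Nat.card (T.comap (QuotientGroup.mk' M)) = Nat.card T * Nat.card M := by
    have h1 := (T.comap (QuotientGroup.mk' M)).card_mul_index
    rw [Subgroup.index_comap_of_surjective _ (QuotientGroup.mk'_surjective M),
      M.card_eq_card_quotient_mul_card_subgroup, ← T.card_mul_index] at h1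
    have h2 : T.index ≠ 0 := Subgroup.index_ne_zero_of_finite
    exact Nat.eq_of_mul_eq_mul_right (Nat.pos_of_ne_zero h2) (by rw [h1]; ring)
  set K := (Subgroup.normalizer (R : Set (H ⧸ M))).comap (QuotientGroup.mk' M) with hK
  set B := (R.comap (QuotientGroup.mk' M)).subgroupOf K with hB
  have hBK : R.comap (QuotientGroup.mk' M) ≤ K := Subgroup.comap_mono Subgroup.le_normalizer
  have hBn : B.Normal := by
    rw [hB, hK, Subgroup.comap_normalizer_eq_of_surjective _ (QuotientGroup.mk'_surjective M)]
    exact Subgroup.normal_in_normalizer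
  have hcardB : Nat.card B = r ^ f * q ^ e := by
    rw [hB, Nat.card_congr (Subgroup.subgroupOfEquivOfLe hBK).toEquiv, hcomap, hf, he]
  have hsK : s ∣ Nat.card K := by
    rw [hK, hcomap]
    exact hd.mul_right _
  let P : Sylow r B := default
  have htop := P.normalizer_sup_eq_top
  set N := Subgroup.normalizer (((P : Subgroup B).map B.subtype : Subgroup K) : Set K) with hN
  have hsN : s ∣ Nat.card N := by
    have h1 : B.index = B.relIndex N := by
      rw [← Subgroup.relIndex_sup_right, htop, Subgroup.relIndex_top_right]
    rw [← B.card_mul_index, hcardB] at hsK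
    refine (Nat.Coprime.dvd_of_dvd_mul_left ?_ hsK).trans (h1 ▸ Subgroup.relIndex_dvd_card B N)
    exact Nat.Coprime.mul_right (Nat.Coprime.pow_right _ ((Nat.coprime_primes hs hr).2 hrs.symm))
      (Nat.Coprime.pow_right _ ((Nat.coprime_primes hs hq).2 hqs.symm))
  refine ⟨((P : Subgroup B).map B.subtype).map K.subtype, (P.2.map _).map _, ?_, ?_⟩
  · rw [Ne, Subgroup.map_eq_bot_iff_of_injective _ K.subtype_injective,
      Subgroup.map_eq_bot_iff_of_injective _ B.subtype_injective]
    refine P.ne_bot_of_dvd_card ?_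
    rw [hcardB]
    exact (dvd_pow_self r hf0).mul_right _
  · refine hsN.trans ?_
    rw [Nat.card_congr (N.equivMapOfInjective _ K.subtype_injective).toEquiv]
    exact Subgroup.card_dvd_of_le (Subgroup.le_normalizer_map _)

theorem exists_pGroup_dvd_card_normalizer {H : Type*} [Group H] [Finite H] [Group.IsSolvable H]
    {r s : ℕ} (hr : r.Prime) (hs : s.Prime) (hrs : r ≠ s)
    (hrd : r ∣ Nat.card H) (hsd : s ∣ Nat.card H) :
    (∃ R : Subgroup H, IsPGroup r R ∧ R ≠ ⊥ ∧ s ∣ Nat.card (Subgroup.normalizer (R : Set H))) ∨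
    (∃ R : Subgroup H, IsPGroup s R ∧ R ≠ ⊥ ∧ r ∣ Nat.card (Subgroup.normalizer (R : Set H))) := by
  induction hN : Nat.card H using Nat.strong_induction_on generalizing H with
  | _ N ih =>
    subst hN
    have : Nontrivial H := by
      rw [← Finite.one_lt_card_iff_nontrivial]
      exact hr.one_lt.trans_le (Nat.le_of_dvd Nat.card_pos hrd)
    obtain ⟨q, M, hq, hMn, hMq, hM⟩ := exists_normal_pGroup (H := H)
    by_cases hqr : q = r
    · subst hqr
      exact Or.inl ⟨M, hMq, hM, by rwa [Subgroup.normalizer_eq_top_iff.2 hMn, Subgroup.card_top]⟩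
    by_cases hqs : q = s
    · subst hqs
      exact Or.inr ⟨M, hMq, hM, by rwa [Subgroup.normalizer_eq_top_iff.2 hMn, Subgroup.card_top]⟩
    have := Fact.mk hq
    obtain ⟨e, he⟩ := IsPGroup.iff_card.1 hMq
    have hmul := M.card_eq_card_quotient_mul_card_subgroup
    have hquot : ∀ l : ℕ, l.Prime → q ≠ l → l ∣ Nat.card H → l ∣ Nat.card (H ⧸ M) := by
      intro l hl hql hd
      rw [hmul, he] at hd
      exact (Nat.Coprime.pow_right e ((Nat.coprime_primes hl hq).2 (Ne.symm hql))).dvd_of_dvd_mul_right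
        hd
    have hlt : Nat.card (H ⧸ M) < Nat.card H := by
      have h1 : 1 < Nat.card M := M.one_lt_card_iff_ne_bot.2 hM
      have h2 : 0 < Nat.card (H ⧸ M) := Nat.card_pos
      nlinarith
    rcases ih _ hlt (hquot r hr hqr hrd) (hquot s hs hqs hsd) rfl with
      ⟨R, h1, h2, h3⟩ | ⟨R, h1, h2, h3⟩
    · exact Or.inl
        (exists_pGroup_dvd_card_normalizer_of_quotient hr hs hq hqs M hMq hrs R h1 h2 h3)
    · exact Or.inr
        (exists_pGroup_dvd_card_normalizer_of_quotient hs hr hq hqr M hMq hrs.symm R h1 h2 h3)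

section LinearGroups

open Module Polynomial

/-- The subspace of vectors fixed by a group of linear automorphisms. -/
def fixedSubspace {F V : Type*} [Field F] [AddCommGroup V] [Module F V]
    (N : Subgroup (V ≃ₗ[F] V)) : Submodule F V where
  carrier := {v | ∀ g ∈ N, g v = v}
  add_mem' ha hb g hg := by rw [map_add, ha g hg, hb g hg]
  zero_mem' g _ := map_zero g
  smul_mem' c v hv g hg := by rw [map_smul, hv g hg]

section
variable {p : ℕ} [Fact p.Prime] {V : Type*} [AddCommGroup V] [Module (ZMod p) V]

theorem fixedSubspace_ne_top {N : Subgroup (V ≃ₗ[ZMod p] V)} (hN : N ≠ ⊥) :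
    fixedSubspace N ≠ ⊤ := by
  contrapose! hN
  rw [Subgroup.eq_bot_iff_forall]
  intro g hg
  ext v
  exact (hN ▸ Submodule.mem_top : v ∈ fixedSubspace N) g hg

theorem apply_mem_fixedSubspace_of_mem_normalizer {N : Subgroup (V ≃ₗ[ZMod p] V)}
    {g : V ≃ₗ[ZMod p] V} (hg : g ∈ Subgroup.normalizer (N : Set (V ≃ₗ[ZMod p] V))) {v : V}
    (hv : v ∈ fixedSubspace N) : g v ∈ fixedSubspace N := by
  intro h hh
  have h1 : g⁻¹ * h * g ∈ N := (Subgroup.mem_normalizer_iff''.1 hg h).1 hh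
  have h2 : g⁻¹ (h (g v)) = v := hv _ h1
  calc h (g v) = g (g⁻¹ (h (g v))) := (LinearEquiv.apply_symm_apply g _).symm
    _ = g v := by rw [h2]

theorem zpowers_le_normalizer_apply_mem {N : Subgroup (V ≃ₗ[ZMod p] V)}
    {g : V ≃ₗ[ZMod p] V} (hg : g ∈ Subgroup.normalizer (N : Set (V ≃ₗ[ZMod p] V))) :
    ∀ h ∈ Subgroup.zpowers g, ∀ v ∈ fixedSubspace N, h v ∈ fixedSubspace N := fun _ hh _ hv =>
  apply_mem_fixedSubspace_of_mem_normalizer (Subgroup.zpowers_le.2 hg hh) hv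

theorem mem_normalizer_zpowers_of_commute {G : Type*} [Group G] {a b : G} (hab : Commute a b) :
    a ∈ Subgroup.normalizer ((Subgroup.zpowers b : Subgroup G) : Set G) := by
  refine Subgroup.centralizer_le_normalizer _ ?_
  rw [Subgroup.mem_centralizer_iff]
  rintro _ ⟨k, rfl⟩
  exact (hab.zpow_right k).symm.eq

theorem isPGroup_zpowers {G : Type*} [Group G] {r : ℕ} {g : G} (hg : orderOf g = r) :
    IsPGroup r (Subgroup.zpowers g) :=
  IsPGroup.of_card (n := 1) (by rw [Nat.card_zpowers, hg, pow_one])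

variable [Module.Finite (ZMod p) V]

/-- If an `r`-group acts linearly over `𝔽_p` on an invariant subspace `U`, then the order of `p`
modulo `r` divides the codimension in `U` of the fixed subspace. -/
theorem orderOf_dvd_finrank_sub {r : ℕ} (hr : r.Prime) (hrp : r ≠ p)
    {N : Subgroup (V ≃ₗ[ZMod p] V)} (hN : IsPGroup r N) {U : Submodule (ZMod p) V}
    (hU : ∀ g ∈ N, ∀ u ∈ U, g u ∈ U) :
    orderOf (p : ZMod r) ∣ finrank (ZMod p) U - finrank (ZMod p) ↥(U ⊓ fixedSubspace N) := by
  have := Fact.mk hr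
  have : Finite V := Module.finite_of_finite (ZMod p)
  let _ : MulAction N U :=
    { smul := fun g u => ⟨g.1 u.1, hU g.1 g.2 u.1 u.2⟩
      one_smul := fun u => rfl
      mul_smul := fun g h u => rfl }
  have h := hN.card_modEq_card_fixedPoints U
  have hfix : Nat.card (MulAction.fixedPoints N U) =
      Nat.card ↥(U ⊓ fixedSubspace N) := by
    refine Nat.card_congr
      { toFun := fun u => ⟨u.1.1, u.1.2, fun g hg => congrArg Subtype.val (u.2 ⟨g, hg⟩)⟩
        invFun := fun u => ⟨⟨u.1, u.2.1⟩, fun g => Subtype.ext (u.2.2 g.1 g.2)⟩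
        left_inv := fun u => rfl
        right_inv := fun u => rfl }
  rw [hfix, Module.natCard_eq_pow_finrank (K := ZMod p),
    Module.natCard_eq_pow_finrank (K := ZMod p) (V := ↥(U ⊓ fixedSubspace N)), Nat.card_zmod] at h
  have hle : finrank (ZMod p) ↥(U ⊓ fixedSubspace N) ≤ finrank (ZMod p) U :=
    Submodule.finrank_mono inf_le_left
  obtain ⟨d, hd⟩ := Nat.exists_eq_add_of_le hle
  rw [hd, Nat.add_sub_cancel_left, orderOf_dvd_iff_pow_eq_one]
  have h2 := (ZMod.natCast_eq_natCast_iff _ _ _).2 h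
  rw [hd] at h2
  push_cast at h2
  have hp0 : (p : ZMod r) ≠ 0 := by
    rw [Ne, ZMod.natCast_eq_zero_iff, Nat.prime_dvd_prime_iff_eq hr Fact.out]
    exact hrp
  rw [pow_add] at h2
  exact mul_left_cancel₀ (pow_ne_zero _ hp0) (h2.trans (mul_one _).symm)

theorem finrank_fixedSubspace_lt {N : Subgroup (V ≃ₗ[ZMod p] V)} (hN : N ≠ ⊥) :
    finrank (ZMod p) (fixedSubspace N) < finrank (ZMod p) V :=
  Submodule.finrank_lt (fixedSubspace_ne_top hN)

theorem orderOf_dvd_finrank_sub_fixedSubspace {r : ℕ} (hr : r.Prime) (hrp : r ≠ p)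
    {N : Subgroup (V ≃ₗ[ZMod p] V)} (hN : IsPGroup r N) :
    orderOf (p : ZMod r) ∣ finrank (ZMod p) V - finrank (ZMod p) (fixedSubspace N) := by
  have := orderOf_dvd_finrank_sub hr hrp hN (U := ⊤) (by simp)
  rwa [finrank_top, top_inf_eq] at this

/-- When `2 j > n`, a nontrivial `r`-group fixes a subspace of codimension exactly `j`. -/
theorem finrank_fixedSubspace_add {r : ℕ} (hr : r.Prime) (hrp : r ≠ p)
    {N : Subgroup (V ≃ₗ[ZMod p] V)} (hN : IsPGroup r N) (hN1 : N ≠ ⊥)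
    (hj : finrank (ZMod p) V < 2 * orderOf (p : ZMod r)) :
    finrank (ZMod p) (fixedSubspace N) + orderOf (p : ZMod r) = finrank (ZMod p) V := by
  obtain ⟨k, hk⟩ := orderOf_dvd_finrank_sub_fixedSubspace hr hrp hN
  have h1 := finrank_fixedSubspace_lt hN1
  have hk1 : k = 1 := by
    rcases k with _ | _ | k
    · simp at hk; omega
    · rfl
    · exfalso
      have : orderOf (p : ZMod r) * 2 ≤ orderOf (p : ZMod r) * (k + 1 + 1) :=
        Nat.mul_le_mul_left _ (by omega)
      omega
  subst hk1
  omega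

/-- An `s`-group normalized by an element of order `r`, where `2 ord_r(p) > n`. -/
theorem exists_dvd_of_normalized_by_large {r s : ℕ} (hr : r.Prime) (hs : s.Prime) (hrp : r ≠ p)
    (hsp : s ≠ p) (hj : finrank (ZMod p) V < 2 * orderOf (p : ZMod r))
    {N : Subgroup (V ≃ₗ[ZMod p] V)} (hN : IsPGroup s N) (hN1 : N ≠ ⊥) {g : V ≃ₗ[ZMod p] V}
    (hg : g ∈ Subgroup.normalizer (N : Set (V ≃ₗ[ZMod p] V))) (hgr : orderOf g = r) :
    ∃ e, 0 < e ∧ e ≤ finrank (ZMod p) V ∧ orderOf (p : ZMod s) ∣ e ∧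
      (e + orderOf (p : ZMod r) ≤ finrank (ZMod p) V ∨ orderOf (p : ZMod r) ≤ e) := by
  have hlt := finrank_fixedSubspace_lt hN1
  refine ⟨finrank (ZMod p) V - finrank (ZMod p) (fixedSubspace N), by omega, by omega,
    orderOf_dvd_finrank_sub_fixedSubspace hs hsp hN, ?_⟩
  have hz1 : Subgroup.zpowers g ≠ ⊥ := by
    rw [Ne, Subgroup.zpowers_eq_bot, ← orderOf_eq_one_iff, hgr]
    exact hr.ne_one
  have hz := finrank_fixedSubspace_add hr hrp (isPGroup_zpowers hgr) hz1 hj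
  have hdvd := orderOf_dvd_finrank_sub hr hrp (isPGroup_zpowers hgr)
    (zpowers_le_normalizer_apply_mem hg)
  have h1 : finrank (ZMod p) ↥(fixedSubspace N ⊓ fixedSubspace (Subgroup.zpowers g)) ≤
      finrank (ZMod p) (fixedSubspace (Subgroup.zpowers g)) := Submodule.finrank_mono inf_le_right
  have h2 : finrank (ZMod p) ↥(fixedSubspace N ⊓ fixedSubspace (Subgroup.zpowers g)) ≤
      finrank (ZMod p) (fixedSubspace N) := Submodule.finrank_mono inf_le_left
  rcases Nat.eq_zero_or_pos (finrank (ZMod p) (fixedSubspace N) -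
    finrank (ZMod p) ↥(fixedSubspace N ⊓ fixedSubspace (Subgroup.zpowers g))) with h0 | h0
  · omega
  · have := Nat.le_of_dvd h0 hdvd
    omega

/-- Commuting elements of prime orders `r`, `s`, where `2 ord_r(p) > n`. -/
theorem orderOf_le_or_dvd_of_commute {r s : ℕ} (hr : r.Prime) (hs : s.Prime) (hrp : r ≠ p)
    (hsp : s ≠ p) (hj : finrank (ZMod p) V < 2 * orderOf (p : ZMod r))
    {x g : V ≃ₗ[ZMod p] V} (hx : orderOf x = r) (hg : orderOf g = s) (hc : Commute x g) :
    orderOf (p : ZMod s) + orderOf (p : ZMod r) ≤ finrank (ZMod p) V ∨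
      orderOf (p : ZMod s) ∣ orderOf (p : ZMod r) := by
  have hx1 : Subgroup.zpowers x ≠ ⊥ := by
    rw [Ne, Subgroup.zpowers_eq_bot, ← orderOf_eq_one_iff, hx]
    exact hr.ne_one
  have hg1 : Subgroup.zpowers g ≠ ⊥ := by
    rw [Ne, Subgroup.zpowers_eq_bot, ← orderOf_eq_one_iff, hg]
    exact hs.ne_one
  have hX := finrank_fixedSubspace_add hr hrp (isPGroup_zpowers hx) hx1 hj
  set X := fixedSubspace (Subgroup.zpowers x)
  set Y := fixedSubspace (Subgroup.zpowers g)
  have h1 : orderOf (p : ZMod s) ∣ finrank (ZMod p) X - finrank (ZMod p) ↥(X ⊓ Y) :=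
    orderOf_dvd_finrank_sub hs hsp (isPGroup_zpowers hg)
      (zpowers_le_normalizer_apply_mem (mem_normalizer_zpowers_of_commute hc.symm))
  have h2 : orderOf (p : ZMod r) ∣ finrank (ZMod p) Y - finrank (ZMod p) ↥(Y ⊓ X) :=
    orderOf_dvd_finrank_sub hr hrp (isPGroup_zpowers hx)
      (zpowers_le_normalizer_apply_mem (mem_normalizer_zpowers_of_commute hc))
  have h3 : orderOf (p : ZMod s) ∣ finrank (ZMod p) V - finrank (ZMod p) Y :=
    orderOf_dvd_finrank_sub_fixedSubspace hs hsp (isPGroup_zpowers hg)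
  have hY : finrank (ZMod p) Y < finrank (ZMod p) V := finrank_fixedSubspace_lt hg1
  have hle : finrank (ZMod p) ↥(X ⊓ Y) ≤ finrank (ZMod p) X := Submodule.finrank_mono inf_le_left
  have hle' : finrank (ZMod p) ↥(Y ⊓ X) ≤ finrank (ZMod p) Y := Submodule.finrank_mono inf_le_left
  rw [inf_comm Y X] at h2 hle'
  by_cases h0 : finrank (ZMod p) X - finrank (ZMod p) ↥(X ⊓ Y) = 0
  · right
    by_cases h0' : finrank (ZMod p) Y - finrank (ZMod p) ↥(X ⊓ Y) = 0
    · convert h3 using 1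
      omega
    · have := Nat.le_of_dvd (Nat.pos_of_ne_zero h0') h2
      omega
  · left
    have := Nat.le_of_dvd (Nat.pos_of_ne_zero h0) h1
    omega
end

theorem exists_injective_algHom_end (F K V : Type*) [Field F] [Field K] [Algebra F K]
    [AddCommGroup V] [Module F V] [Module.Finite F V] :
    ∃ φ : Module.End F V →ₐ[F] Module.End K (Fin (finrank F V) → K), Function.Injective φ := by
  let b := Module.finBasis F V
  refine ⟨((Matrix.toLinAlgEquiv' (R := K)).restrictScalars F : _ ≃ₐ[F] _).toAlgHom.comp
    ((Algebra.ofId F K).mapMatrix.comp (LinearMap.toMatrixAlgEquiv b).toAlgHom), ?_⟩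
  intro x y h
  have h1 := ((Matrix.toLinAlgEquiv' (R := K)).restrictScalars F).injective h
  refine (LinearMap.toMatrixAlgEquiv b).injective ?_
  ext i j
  have h2 := congrFun (congrFun h1 i) j
  exact (algebraMap F K).injective h2

theorem aeval_pow_char_eq_zero {p : ℕ} [Fact p.Prime] {K : Type*} [Field K] [Algebra (ZMod p) K]
    {f : (ZMod p)[X]} {a : K} (h : aeval a f = 0) (t : ℕ) : aeval (a ^ p ^ t) f = 0 := by
  induction t with
  | zero => simpa using h
  | succ t ih =>
    rw [pow_succ, pow_mul, ← expand_aeval, ZMod.expand_card, map_pow, ih,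
      zero_pow (Fact.out : p.Prime).ne_zero]

theorem pow_prime_pow_injOn {p r : ℕ} [Fact p.Prime] (hr : r.Prime) {K : Type*}
    [Field K] {a : K} (ha : a ^ r = 1) (ha1 : a ≠ 1) :
    Set.InjOn (fun t => a ^ p ^ t) (Set.Iio (orderOf (p : ZMod r))) := by
  intro u hu v hv h
  have hord : orderOf a = r := by
    have := Fact.mk hr
    exact orderOf_eq_prime ha ha1
  refine pow_injOn_Iio_orderOf (x := (p : ZMod r)) hu hv ?_
  have h1 : p ^ u ≡ p ^ v [MOD orderOf a] := by
    have hpos : 0 < orderOf a := hord ▸ hr.pos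
    refine pow_injOn_Iio_orderOf (x := a) (Nat.mod_lt _ hpos) (Nat.mod_lt _ hpos) ?_
    simpa only [pow_mod_orderOf] using h
  rw [hord, ← ZMod.natCast_eq_natCast_iff] at h1
  simpa using h1

theorem exists_eq_pow_of_aeval_eq_zero {p r : ℕ} [Fact p.Prime] (hr : r.Prime)
    {K : Type*} [Field K] [Algebra (ZMod p) K] {f : (ZMod p)[X]} (hf0 : f ≠ 0)
    (hf : f.natDegree < 2 * orderOf (p : ZMod r)) {a c : K} (ha : aeval a f = 0)
    (hc : aeval c f = 0) (har : a ^ r = 1) (hcr : c ^ r = 1) (ha1 : a ≠ 1) (hc1 : c ≠ 1) :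
    ∃ t, c = a ^ p ^ t := by
  classical
  by_contra! hne
  have := Fact.mk hr
  set j := orderOf (p : ZMod r) with hj
  have hsub : (Finset.range j).image (fun t => a ^ p ^ t) ∪
      (Finset.range j).image (fun t => c ^ p ^ t) ⊆ (f.aroots K).toFinset := by
    intro z hz
    rw [Multiset.mem_toFinset, mem_aroots]
    simp only [Finset.mem_union, Finset.mem_image] at hz
    rcases hz with ⟨t, -, rfl⟩ | ⟨t, -, rfl⟩
    · exact ⟨hf0, aeval_pow_char_eq_zero ha t⟩
    · exact ⟨hf0, aeval_pow_char_eq_zero hc t⟩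
  have hdisj : Disjoint ((Finset.range j).image (fun t => a ^ p ^ t))
      ((Finset.range j).image (fun t => c ^ p ^ t)) := by
    rw [Finset.disjoint_left]
    intro z hz1 hz2
    obtain ⟨u, -, rfl⟩ := Finset.mem_image.1 hz1
    obtain ⟨v, hv, h⟩ := Finset.mem_image.1 hz2
    have hv' : v < j := Finset.mem_range.1 hv
    refine hne (u + (j - v)) ?_
    have h1 : c ^ p ^ j = c := by
      have h2 : p ^ j ≡ 1 [MOD orderOf c] := by
        rw [orderOf_eq_prime hcr hc1, ← ZMod.natCast_eq_natCast_iff]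
        push_cast
        exact pow_orderOf_eq_one _
      rw [← pow_mod_orderOf, h2, pow_mod_orderOf, pow_one]
    calc c = c ^ p ^ (v + (j - v)) := by rw [Nat.add_sub_cancel' hv'.le, h1]
      _ = a ^ p ^ (u + (j - v)) := by rw [pow_add, pow_mul, h, ← pow_mul, ← pow_add]
  have hcard : ∀ b : K, b ^ r = 1 → b ≠ 1 →
      ((Finset.range j).image (fun t => b ^ p ^ t)).card = j := by
    intro b hb hb1
    rw [Finset.card_image_of_injOn, Finset.card_range]
    rw [Finset.coe_range]
    exact pow_prime_pow_injOn hr hb hb1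
  have h1 := Finset.card_le_card hsub
  rw [Finset.card_union_of_disjoint hdisj, hcard a har ha1, hcard c hcr hc1] at h1
  have h2 := (Multiset.toFinset_card_le (f.aroots K)).trans
    ((card_roots' _).trans natDegree_map_le)
  omega

/-- Commuting endomorphisms `x`, `y` with `x ^ r = 1`, `x ≠ 1` have a common eigenvector
on which `x` acts nontrivially. -/
theorem exists_common_eigenvector {K W : Type*} [Field K] [IsAlgClosed K] [AddCommGroup W]
    [Module K W] [FiniteDimensional K W] {x y : Module.End K W} (hxy : Commute x y) {r : ℕ}
    (hr : (r : K) ≠ 0) (hx : x ^ r = 1) (hx1 : x ≠ 1) :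
    ∃ (a c : K) (v : W), v ≠ 0 ∧ a ≠ 1 ∧ x v = a • v ∧ y v = c • v := by
  obtain ⟨a, ha, ha1⟩ : ∃ a : K, x.HasEigenvalue a ∧ a ≠ 1 := by
    have hnt : Nontrivial (LinearMap.range (x - 1)) := by
      rw [Submodule.nontrivial_iff_ne_bot, Ne, LinearMap.range_eq_bot, sub_eq_zero]
      exact hx1
    have hmaps : ∀ w ∈ LinearMap.range (x - 1), x w ∈ LinearMap.range (x - 1) := by
      rintro _ ⟨u, rfl⟩
      exact ⟨x u, by simp⟩
    obtain ⟨a, ha⟩ := Module.End.exists_eigenvalue (x.restrict hmaps)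
    obtain ⟨w, hw⟩ := ha.exists_hasEigenvector
    have hxw : x w.1 = a • w.1 := congrArg Subtype.val hw.apply_eq_smul
    have hw0 : w.1 ≠ 0 := fun h => hw.2 (Subtype.ext h)
    refine ⟨a, Module.End.hasEigenvalue_of_hasEigenvector
      ⟨Module.End.mem_eigenspace_iff.2 hxw, hw0⟩, ?_⟩
    rintro rfl
    rw [one_smul] at hxw
    obtain ⟨u, hu⟩ := w.2
    have hk (k : ℕ) : (x ^ k) w.1 = w.1 := by
      induction k with
      | zero => simp
      | succ k ih => rw [pow_succ, Module.End.mul_apply, hxw, ih]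
    have h1 := LinearMap.congr_fun (geom_sum_mul x r) u
    rw [hx, sub_self, Module.End.mul_apply, hu, LinearMap.sum_apply] at h1
    simp only [hk, Finset.sum_const, Finset.card_range, LinearMap.zero_apply] at h1
    rw [← Nat.cast_smul_eq_nsmul K, smul_eq_zero] at h1
    exact h1.elim hr hw0
  have hnt : Nontrivial (x.eigenspace a) := (Submodule.nontrivial_iff_ne_bot).2 ha
  have hmaps : ∀ w ∈ x.eigenspace a, y w ∈ x.eigenspace a := by
    intro w hw
    rw [Module.End.mem_eigenspace_iff] at hw ⊢
    rw [← Module.End.mul_apply, hxy.eq, Module.End.mul_apply, hw, map_smul]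
  obtain ⟨c, hc⟩ := Module.End.exists_eigenvalue (y.restrict hmaps)
  obtain ⟨v, hv⟩ := hc.exists_hasEigenvector
  exact ⟨a, c, v.1, fun h => hv.2 (Subtype.ext h), ha1, Module.End.mem_eigenspace_iff.1 v.2,
    congrArg Subtype.val hv.apply_eq_smul⟩

theorem aeval_apply_of_apply_eq_smul {F K W : Type*} [Field F] [Field K] [Algebra F K]
    [AddCommGroup W] [Module F W] [Module K W] [IsScalarTower F K W] {A : Module.End K W}
    {a : K} {v : W}
    (h : A v = a • v) (f : F[X]) : aeval A f v = aeval a f • v := by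
  have hp (k : ℕ) : (A ^ k) v = a ^ k • v := by
    induction k with
    | zero => simp
    | succ k ih => rw [pow_succ, Module.End.mul_apply, h, map_smul, ih, smul_smul, pow_succ']
  induction f using Polynomial.induction_on' with
  | add f g hf hg => simp [hf, hg, add_smul]
  | monomial k c =>
    simp only [aeval_monomial, hp, Module.End.mul_apply, mul_smul, Module.algebraMap_end_apply,
      algebraMap_smul]

section
variable {p : ℕ} [Fact p.Prime] {V : Type*} [AddCommGroup V] [Module (ZMod p) V]
  [Module.Finite (ZMod p) V]

theorem fixedSubspace_zpowers_le_of_commute {r : ℕ} (hr : r.Prime) (hrp : r ≠ p)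
    (hj : finrank (ZMod p) V < 2 * orderOf (p : ZMod r)) {x z : V ≃ₗ[ZMod p] V}
    (hx : orderOf x = r) (hz : orderOf z = r) (hc : Commute x z) :
    fixedSubspace (Subgroup.zpowers z) ≤ fixedSubspace (Subgroup.zpowers x) := by
  have hz1 : Subgroup.zpowers z ≠ ⊥ := by
    rw [Ne, Subgroup.zpowers_eq_bot, ← orderOf_eq_one_iff, hz]
    exact hr.ne_one
  have hfix := finrank_fixedSubspace_add hr hrp (isPGroup_zpowers hz) hz1 hj
  have hdvd := orderOf_dvd_finrank_sub hr hrp (isPGroup_zpowers hx)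
    (zpowers_le_normalizer_apply_mem (mem_normalizer_zpowers_of_commute hc))
  have h0 := Nat.eq_zero_of_dvd_of_lt hdvd (by omega)
  have hle : finrank (ZMod p)
      ↥(fixedSubspace (Subgroup.zpowers z) ⊓ fixedSubspace (Subgroup.zpowers x)) ≤
      finrank (ZMod p) (fixedSubspace (Subgroup.zpowers z)) := Submodule.finrank_mono inf_le_left
  rw [← inf_eq_left]
  exact Submodule.eq_of_le_of_finrank_eq inf_le_left (by omega)

/-- A conjugate of an element `x` of prime order `r` commuting with `x` is a Galois power of
`x`, provided that `2 ord_r(p)` exceeds the dimension. -/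
theorem exists_conj_eq_pow_of_commute {r : ℕ} (hr : r.Prime) (hrp : r ≠ p)
    (hj : finrank (ZMod p) V < 2 * orderOf (p : ZMod r)) {x g : V ≃ₗ[ZMod p] V}
    (hx : orderOf x = r) (hc : Commute x (g * x * g⁻¹)) : ∃ t, g * x * g⁻¹ = x ^ p ^ t := by
  have := Fact.mk hr
  let K := AlgebraicClosure (ZMod p)
  obtain ⟨φ, hφ⟩ := exists_injective_algHom_end (ZMod p) K V
  let T := LinearEquiv.automorphismGroup.toLinearMapMonoidHom (R := ZMod p) (M := V)
  have hT : Function.Injective T := LinearEquiv.toLinearMap_injective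
  set y := g * x * g⁻¹ with hy
  have hrK : (r : K) ≠ 0 := by
    have : CharP K p := charP_of_injective_algebraMap (algebraMap (ZMod p) K).injective p
    rw [Ne, CharP.cast_eq_zero_iff K p, Nat.prime_dvd_prime_iff_eq Fact.out hr]
    exact fun h => hrp h.symm
  have hxr : x ^ r = 1 := hx ▸ pow_orderOf_eq_one x
  have hyr : y ^ r = 1 := by rw [hy, conj_pow, hxr, mul_one, mul_inv_cancel]
  have hx1 : x ≠ 1 := by
    rw [Ne, ← orderOf_eq_one_iff, hx]
    exact hr.ne_one
  have hy1 : y ≠ 1 := by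
    rw [hy, Ne, conj_eq_one_iff]
    exact hx1
  let ψ : (V ≃ₗ[ZMod p] V) →* Module.End K (Fin (finrank (ZMod p) V) → K) :=
    (φ : _ →* _).comp T
  have hψ : Function.Injective ψ := hφ.comp hT
  obtain ⟨a, c, v, hv0, ha1, hxv, hyv⟩ := exists_common_eigenvector (hc.map ψ) hrK
    (by rw [← map_pow, hxr, map_one]) (fun h => hx1 (hψ (h.trans (map_one ψ).symm)))
  have hpow {A : V ≃ₗ[ZMod p] V} {d : K} (h : ψ A v = d • v) (k : ℕ) :
      ψ (A ^ k) v = d ^ k • v := by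
    have := aeval_apply_of_apply_eq_smul (F := ZMod p) h (X ^ k)
    rwa [map_pow, map_pow, aeval_X, aeval_X, ← map_pow] at this
  have hone {A : V ≃ₗ[ZMod p] V} {d : K} (h : ψ A v = d • v) (hA : A ^ r = 1) : d ^ r = 1 := by
    have h1 := hpow h r
    rw [hA, map_one, Module.End.one_apply] at h1
    exact smul_left_injective K hv0 (by simpa using h1.symm)
  set f := minpoly (ZMod p) (T x) with hf
  have hfy : minpoly (ZMod p) (T y) = f :=
    minpoly.algEquiv_eq (LinearEquiv.conjAlgEquiv (ZMod p) g) (T x)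
  have hroot {A : V ≃ₗ[ZMod p] V} {d : K} (h : ψ A v = d • v)
      (hA : minpoly (ZMod p) (T A) = f) : aeval d f = 0 := by
    have h1 := aeval_apply_of_apply_eq_smul (F := ZMod p) h f
    have h2 : aeval (ψ A) f = 0 := by
      change aeval (φ (T A)) f = 0
      rw [aeval_algHom_apply, ← hA, minpoly.aeval, map_zero]
    rw [h2, LinearMap.zero_apply] at h1
    exact (smul_eq_zero.1 h1.symm).resolve_right hv0
  have hf0 : f ≠ 0 := minpoly.ne_zero (Algebra.IsIntegral.isIntegral _)
  have hfdeg : f.natDegree ≤ finrank (ZMod p) V := by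
    rw [← LinearMap.charpoly_natDegree (T x)]
    exact natDegree_le_of_dvd (LinearMap.minpoly_dvd_charpoly _) (LinearMap.charpoly_monic _).ne_zero
  have key (b : ℕ) (hb : c = a ^ b) : y = x ^ b := by
    by_contra hne
    have hcz : Commute x ((x ^ b)⁻¹ * y) :=
      ((Commute.refl x).pow_right b).inv_right.mul_right hc
    set z := (x ^ b)⁻¹ * y with hz
    have hz1 : z ≠ 1 := by
      rw [hz, Ne, inv_mul_eq_one]
      exact fun h => hne h.symm
    have hzr : z ^ r = 1 := by
      rw [hz, ((hc.pow_left b).inv_left).mul_pow, hyr, inv_pow, ← pow_mul, mul_comm b r, pow_mul,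
        hxr, one_pow, inv_one, one_mul]
    have hzv : ψ z v = v := by
      rw [hz, map_mul, Module.End.mul_apply, hyv, hb, ← hpow hxv, ← Module.End.mul_apply,
        ← map_mul, inv_mul_cancel, map_one, Module.End.one_apply]
    have hle := fixedSubspace_zpowers_le_of_commute hr hrp hj hx (orderOf_eq_prime hzr hz1) hcz
    have hend : T x * ∑ k ∈ Finset.range r, T z ^ k = ∑ k ∈ Finset.range r, T z ^ k := by
      ext w
      have hmem : (∑ k ∈ Finset.range r, T z ^ k) w ∈ fixedSubspace (Subgroup.zpowers z) := by
        have h1 : T z * ∑ k ∈ Finset.range r, T z ^ k = ∑ k ∈ Finset.range r, T z ^ k := by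
          have h2 := mul_geom_sum (T z) r
          rwa [← map_pow, hzr, map_one, sub_self, sub_mul, one_mul, sub_eq_zero] at h2
        intro h hh
        have hstab : Subgroup.zpowers z ≤ MulAction.stabilizer (V ≃ₗ[ZMod p] V)
            ((∑ k ∈ Finset.range r, T z ^ k) w) :=
          Subgroup.zpowers_le.2 (LinearMap.congr_fun h1 w)
        exact hstab hh
      exact hle hmem x (Subgroup.mem_zpowers x)
    have h1 := LinearMap.congr_fun (congrArg φ hend) v
    have h2 : φ (∑ k ∈ Finset.range r, T z ^ k) v = (r : K) • v := by
      rw [map_sum, LinearMap.sum_apply, Finset.sum_congr rfl (g := fun _ => v), Finset.sum_const,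
        Finset.card_range, Nat.cast_smul_eq_nsmul]
      intro k _
      have := hpow (hzv.trans (one_smul K v).symm) k
      rw [one_pow, one_smul] at this
      rw [← map_pow]
      exact this
    rw [map_mul, Module.End.mul_apply, h2, map_smul] at h1
    have h3 : φ (T x) v = a • v := hxv
    rw [h3, smul_right_injective _ hrK |>.eq_iff] at h1
    exact ha1 (smul_left_injective K hv0 (by simpa using h1))
  by_cases hc1 : c = 1
  · exact absurd (key 0 (by rw [hc1, pow_zero])) (by rwa [pow_zero])
  · obtain ⟨t, ht⟩ := exists_eq_pow_of_aeval_eq_zero hr hf0 (by omega) (hroot hxv rfl)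
      (hroot hyv hfy) (hone hxv hxr) (hone hyv hyr) ha1 hc1
    exact ⟨t, key _ ht⟩

/-- A nontrivial `r`-group normalized by an element of prime order `s`, where `2 ord_r(p)` exceeds
the dimension. -/
theorem dvd_or_le_or_dvd_of_mem_normalizer {r s : ℕ} (hr : r.Prime) (hs : s.Prime) (hrp : r ≠ p)
    (hsp : s ≠ p) (hj : finrank (ZMod p) V < 2 * orderOf (p : ZMod r))
    {N : Subgroup (V ≃ₗ[ZMod p] V)} (hN : IsPGroup r N) (hN1 : N ≠ ⊥) {g : V ≃ₗ[ZMod p] V}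
    (hg : g ∈ Subgroup.normalizer (N : Set (V ≃ₗ[ZMod p] V))) (hgs : orderOf g = s) :
    s ∣ orderOf (p : ZMod r) ∨
      orderOf (p : ZMod s) + orderOf (p : ZMod r) ≤ finrank (ZMod p) V ∨
      orderOf (p : ZMod s) ∣ orderOf (p : ZMod r) := by
  have := Fact.mk hr
  have : Finite V := Module.finite_of_finite (ZMod p)
  have : Finite (V ≃ₗ[ZMod p] V) := Finite.of_injective (fun e => (e : V → V)) DFunLike.coe_injective
  rw [or_iff_not_imp_left]
  intro hsj
  have : Nontrivial N := (Subgroup.nontrivial_iff_ne_bot N).2 hN1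
  have hZ : Nontrivial (Subgroup.center N) := hN.center_nontrivial
  obtain ⟨k, hk⟩ := (IsPGroup.iff_card (p := r)).1 (hN.to_subgroup (Subgroup.center N))
  have hdvd : r ∣ Nat.card (Subgroup.center N) := by
    have h1 := Finite.one_lt_card (α := Subgroup.center N)
    rw [hk] at h1 ⊢
    exact dvd_pow_self r (fun h => by simp [h] at h1)
  obtain ⟨x, hx⟩ := exists_prime_orderOf_dvd_card' r hdvd
  set X : V ≃ₗ[ZMod p] V := x.1.1 with hX
  have hXr : orderOf X = r := by rw [hX, Subgroup.orderOf_coe, Subgroup.orderOf_coe, hx]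
  have hconj : g * X * g⁻¹ ∈ N := (Subgroup.mem_normalizer_iff.1 hg X).1 x.1.2
  have hcomm : Commute X (g * X * g⁻¹) :=
    (congrArg Subtype.val (Subgroup.mem_center_iff.1 x.2 ⟨_, hconj⟩)).symm
  obtain ⟨t, ht⟩ := exists_conj_eq_pow_of_commute hr hrp hj hXr hcomm
  have hiter (k : ℕ) : g ^ k * X * (g ^ k)⁻¹ = X ^ p ^ (t * k) := by
    induction k with
    | zero => simp
    | succ k ih =>
      calc g ^ (k + 1) * X * (g ^ (k + 1))⁻¹ = g * (g ^ k * X * (g ^ k)⁻¹) * g⁻¹ := by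
            rw [pow_succ']; group
        _ = X ^ p ^ (t * (k + 1)) := by
            rw [ih, ← conj_pow, ht, ← pow_mul, ← pow_add]; congr 2; ring
  have hpow : X ^ p ^ (t * orderOf (p : ZMod r)) = X := by
    have h1 : p ^ (t * orderOf (p : ZMod r)) ≡ 1 [MOD orderOf X] := by
      rw [hXr, ← ZMod.natCast_eq_natCast_iff]
      push_cast
      rw [mul_comm, pow_mul, pow_orderOf_eq_one, one_pow]
    rw [← pow_mod_orderOf, h1, pow_mod_orderOf, pow_one]
  have hcj : Commute (g ^ orderOf (p : ZMod r)) X :=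
    mul_inv_eq_iff_eq_mul.1 ((hiter _).trans hpow)
  have hcop : (orderOf (p : ZMod r)).Coprime (orderOf g) := by
    rw [hgs]
    exact ((Nat.Prime.coprime_iff_not_dvd hs).2 hsj).symm
  obtain ⟨m, hm⟩ := exists_pow_eq_self_of_coprime hcop
  have hcg : Commute X g := by
    have := hcj.pow_left m
    rw [hm] at this
    exact this.symm
  exact orderOf_le_or_dvd_of_commute hr hs hrp hsp hj hXr hgs hcg
end

end LinearGroups

/-- A faithful representation transports the local structure of a solvable subgroup. -/
theorem exists_pGroup_normalized_of_isSolvable {G L : Type*} [Group G] [Finite G] [Group L]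
    {φ : G →* L} (hφ : Function.Injective φ) {r s : ℕ} (hr : r.Prime) (hs : s.Prime)
    (hrs : r ≠ s) {H : Subgroup G} (hH : Group.IsSolvable H) (hd : r * s ∣ Nat.card H) :
    (∃ (N : Subgroup L) (g : L), IsPGroup r N ∧ N ≠ ⊥ ∧
      g ∈ Subgroup.normalizer (N : Set L) ∧ orderOf g = s) ∨
    (∃ (N : Subgroup L) (g : L), IsPGroup s N ∧ N ≠ ⊥ ∧
      g ∈ Subgroup.normalizer (N : Set L) ∧ orderOf g = r) := by
  have hinj : Function.Injective (φ.comp H.subtype) := hφ.comp H.subtype_injective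
  have key {q t : ℕ} (ht : t.Prime) {R : Subgroup H} (hR : IsPGroup q R) (hR1 : R ≠ ⊥)
      (hdvd : t ∣ Nat.card (Subgroup.normalizer (R : Set H))) :
      ∃ (N : Subgroup L) (g : L), IsPGroup q N ∧ N ≠ ⊥ ∧
        g ∈ Subgroup.normalizer (N : Set L) ∧ orderOf g = t := by
    have := Fact.mk ht
    obtain ⟨g, hg⟩ := exists_prime_orderOf_dvd_card' t hdvd
    refine ⟨R.map (φ.comp H.subtype), φ.comp H.subtype g.1, hR.map _, ?_,
      Subgroup.le_normalizer_map _ (Subgroup.mem_map_of_mem _ g.2), ?_⟩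
    · rwa [Ne, Subgroup.map_eq_bot_iff_of_injective _ hinj]
    · rw [orderOf_injective _ hinj, Subgroup.orderOf_coe, hg]
  rcases exists_pGroup_dvd_card_normalizer hr hs hrs ((Dvd.intro _ rfl).trans hd)
    ((Dvd.intro_left _ rfl).trans hd) with ⟨R, h1, h2, h3⟩ | ⟨R, h1, h2, h3⟩
  · exact Or.inl (key hs h1 h2 h3)
  · exact Or.inr (key hr h1 h2 h3)

theorem exists_isSolvable_mul_dvd_card {G : Type*} [Group G] [Finite G] {r s : ℕ} (hr : r.Prime)
    (hs : s.Prime) (hrs : r ≠ s) {x g : G} (hx : orderOf x = r) (hg : orderOf g = s) {k : ℕ}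
    (hconj : g * x * g⁻¹ = x ^ k) :
    ∃ H : Subgroup G, Group.IsSolvable H ∧ r * s ∣ Nat.card H := by
  have hmem : g ∈ Subgroup.normalizer ((Subgroup.zpowers x : Subgroup G) : Set G) := by
    refine Subgroup.mem_normalizer_fintype ?_
    rintro _ ⟨m, rfl⟩
    exact ⟨k * m, by simp only [zpow_mul, zpow_natCast, ← hconj, conj_zpow]⟩
  have hle : Subgroup.zpowers g ≤
      Subgroup.normalizer ((Subgroup.zpowers x : Subgroup G) : Set G) := Subgroup.zpowers_le.2 hmem
  refine ⟨Subgroup.zpowers g ⊔ Subgroup.zpowers x, ?_, ?_⟩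
  · have hn : ((Subgroup.zpowers x).subgroupOf
        (Subgroup.zpowers g ⊔ Subgroup.zpowers x)).Normal :=
      Subgroup.normal_subgroupOf_sup_of_le_normalizer hle
    rw [Group.isSolvable_iff_subgroup_quotient ((Subgroup.zpowers x).subgroupOf
        (Subgroup.zpowers g ⊔ Subgroup.zpowers x))]
    have hn' := Subgroup.normal_subgroupOf_of_le_normalizer hle
    let e := Subgroup.subgroupOfEquivOfLe
      (le_sup_right : Subgroup.zpowers x ≤ Subgroup.zpowers g ⊔ Subgroup.zpowers x)
    exact ⟨Group.isSolvable_of_isSolvable_injective (f := e.toMonoidHom) e.injective,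
      Group.isSolvable_of_surjective
        (f := (QuotientGroup.quotientInfEquivProdNormalizerQuotient _ _ hle).toMonoidHom)
        (QuotientGroup.quotientInfEquivProdNormalizerQuotient _ _ hle).surjective⟩
  · rw [← hx, ← hg]
    refine Nat.Coprime.mul_dvd_of_dvd_of_dvd ?_ ?_ ?_
    · rw [hx, hg]
      exact (Nat.coprime_primes hr hs).2 hrs
    · exact Subgroup.orderOf_dvd_natCard _ (Subgroup.mem_sup_right (Subgroup.mem_zpowers x))
    · exact Subgroup.orderOf_dvd_natCard _ (Subgroup.mem_sup_left (Subgroup.mem_zpowers g))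

section
variable {V : Type*} {Γ : SimpleGraph V}

theorem mem_closedNbhd {u v : V} : v ∈ closedNbhd Γ u ↔ v = u ∨ Γ.Adj u v := Iff.rfl

theorem mk_ne_mk_of_adj_of_not_adj {u v w : V} (hu : Γ.Adj u w) (hw : w ≠ v) (hv : ¬ Γ.Adj v w) :
    Quotient.mk (nbhdSetoid Γ) u ≠ Quotient.mk (nbhdSetoid Γ) v := by
  intro h
  have h1 : closedNbhd Γ u = closedNbhd Γ v := Quotient.exact h
  have h2 : w ∈ closedNbhd Γ v := h1 ▸ (mem_closedNbhd.2 (Or.inr hu))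
  exact (mem_closedNbhd.1 h2).elim hw hv

theorem mem_closedNbhd_of_mk_eq_or_adj {a b : V}
    (h : Quotient.mk (nbhdSetoid Γ) a = Quotient.mk (nbhdSetoid Γ) b ∨
      (compactForm Γ).Adj (Quotient.mk (nbhdSetoid Γ) a) (Quotient.mk (nbhdSetoid Γ) b)) :
    a = b ∨ Γ.Adj b a := by
  rcases h with h | ⟨-, u, v, hu, hv, huv⟩
  · have h1 : closedNbhd Γ a = closedNbhd Γ b := Quotient.exact h
    exact mem_closedNbhd.1 (h1 ▸ mem_closedNbhd.2 (Or.inl rfl))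
  · have h1 : closedNbhd Γ u = closedNbhd Γ a := Quotient.exact hu
    have h2 : closedNbhd Γ v = closedNbhd Γ b := Quotient.exact hv
    have h3 : v ∈ closedNbhd Γ a := h1 ▸ mem_closedNbhd.2 (Or.inr huv)
    rw [← mem_closedNbhd, ← h2, mem_closedNbhd]
    rcases mem_closedNbhd.1 h3 with rfl | h4
    · exact Or.inl rfl
    · exact Or.inr h4.symm

/-- If `ab` and `cd` are edges spanning no further edges, and the ends of each are distinguished by
some vertex, then the compact form contains an induced `2K₂` and hence is not split. -/
theorem not_isSplit_compactForm {a b c d e f : V} (hab : Γ.Adj a b) (hcd : Γ.Adj c d)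
    (hae : Γ.Adj a e) (hbe : ¬ Γ.Adj b e) (heb : e ≠ b) (hcf : Γ.Adj c f) (hdf : ¬ Γ.Adj d f)
    (hfd : f ≠ d) (hac : ¬ Γ.Adj a c) (had : ¬ Γ.Adj a d) (hbc : ¬ Γ.Adj b c) (hbd : ¬ Γ.Adj b d)
    (hac' : a ≠ c) (had' : a ≠ d) (hbc' : b ≠ c) (hbd' : b ≠ d) :
    ¬ (compactForm Γ).IsSplit Set.univ := by
  rintro ⟨C, I, hCI, -, hC, hI⟩
  have hend {u v w : V} (huv : Γ.Adj u v) (huw : Γ.Adj u w) (hwv : w ≠ v) (hvw : ¬ Γ.Adj v w) :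
      Quotient.mk (nbhdSetoid Γ) u ∈ C ∨ Quotient.mk (nbhdSetoid Γ) v ∈ C := by
    by_contra! h
    have hmem {q} (hq : q ∉ C) : q ∈ I :=
      ((hCI ▸ Set.mem_univ q : q ∈ C ∪ I)).resolve_left hq
    have hne := mk_ne_mk_of_adj_of_not_adj huw hwv hvw
    exact hI (hmem h.1) (hmem h.2) hne ⟨hne, u, v, rfl, rfl, huv⟩
  have hclique {u v : V} (hu : Quotient.mk (nbhdSetoid Γ) u ∈ C)
      (hv : Quotient.mk (nbhdSetoid Γ) v ∈ C) : u = v ∨ Γ.Adj v u := by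
    refine mem_closedNbhd_of_mk_eq_or_adj (or_iff_not_imp_left.2 fun hne => hC hu hv hne)
  rcases hend hab hae heb hbe with h1 | h1 <;> rcases hend hcd hcf hfd hdf with h2 | h2
  · exact (hclique h1 h2).elim hac' fun h => hac h.symm
  · exact (hclique h1 h2).elim had' fun h => had h.symm
  · exact (hclique h1 h2).elim hbc' fun h => hbc h.symm
  · exact (hclique h1 h2).elim hbd' fun h => hbd h.symm
end

section Constructions

open Module

theorem ZMod.eq_one_of_pow_eq_one_of_coprime {p : ℕ} [Fact p.Prime] {q : ℕ} (hq : q ≠ 0)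
    (hqp : q.Coprime (p - 1)) {a : ZMod p} (ha : a ^ q = 1) : a = 1 := by
  have ha0 : a ≠ 0 := by
    rintro rfl
    rw [zero_pow hq] at ha
    exact zero_ne_one ha
  rw [← orderOf_eq_one_iff, ← Nat.dvd_one, ← hqp]
  exact Nat.dvd_gcd (orderOf_dvd_of_pow_eq_one ha)
    (orderOf_dvd_of_pow_eq_one (ZMod.pow_card_sub_one_eq_one ha0))

namespace Matrix.SpecialLinearGroup
variable {p n : ℕ} [Fact p.Prime]

theorem center_eq_bot_of_coprime (hn : n ≠ 0) (hnp : n.Coprime (p - 1)) :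
    Subgroup.center (SpecialLinearGroup (Fin n) (ZMod p)) = ⊥ := by
  rw [Subgroup.eq_bot_iff_forall]
  intro A hA
  obtain ⟨a, ha, haA⟩ := mem_center_iff.1 hA
  rw [Fintype.card_fin] at ha
  rw [ZMod.eq_one_of_pow_eq_one_of_coprime hn hnp ha, map_one] at haA
  exact Subtype.ext haA.symm

theorem exists_toLin'_eq {q : ℕ} (hq : q ≠ 0) (hqp : q.Coprime (p - 1))
    {g : (Fin n → ZMod p) ≃ₗ[ZMod p] (Fin n → ZMod p)} (hg : g ^ q = 1) :
    ∃ A : SpecialLinearGroup (Fin n) (ZMod p), toLin' A = g := by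
  have hdet : LinearMap.det (g : (Fin n → ZMod p) →ₗ[ZMod p] (Fin n → ZMod p)) = 1 := by
    refine ZMod.eq_one_of_pow_eq_one_of_coprime hq hqp ?_
    rw [← map_pow]
    have h1 := congrArg (LinearEquiv.automorphismGroup.toLinearMapMonoidHom
      (R := ZMod p) (M := Fin n → ZMod p)) hg
    rw [map_pow, map_one] at h1
    exact (congrArg LinearMap.det h1).trans (map_one _)
  refine ⟨⟨LinearMap.toMatrix' (g : (Fin n → ZMod p) →ₗ[ZMod p] (Fin n → ZMod p)), ?_⟩, ?_⟩
  · rw [LinearMap.det_toMatrix', hdet]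
  · refine LinearEquiv.toLinearMap_injective ?_
    exact (toLin'_to_linearMap _).trans (Matrix.toLin'_toMatrix' _)

/-- Elements of a linear group of prime orders `r`, `s` not dividing `p - 1`, the second
normalizing the cyclic group generated by the first, yield a solvable subgroup of any group
isomorphic to `SL_n(p)`. -/
theorem exists_isSolvable_mul_dvd_card {P : Type*} [Group P] [Finite P]
    (E : SpecialLinearGroup (Fin n) (ZMod p) ≃* P)
    {W : Type*} [AddCommGroup W] [Module (ZMod p) W] [Module.Finite (ZMod p) W]
    (hW : finrank (ZMod p) W = n) {r s : ℕ} (hr : r.Prime) (hs : s.Prime) (hrs : r ≠ s)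
    (hrp : ¬ r ∣ p - 1) (hsp : ¬ s ∣ p - 1) {x g : W ≃ₗ[ZMod p] W} (hx : orderOf x = r)
    (hg : orderOf g = s) {k : ℕ} (hconj : g * x * g⁻¹ = x ^ k) :
    ∃ H : Subgroup P, Group.IsSolvable H ∧ r * s ∣ Nat.card H := by
  let e : W ≃ₗ[ZMod p] (Fin n → ZMod p) :=
    LinearEquiv.ofFinrankEq _ _ (by rw [hW, finrank_fin_fun])
  let Θ : (W ≃ₗ[ZMod p] W) →* ((Fin n → ZMod p) ≃ₗ[ZMod p] (Fin n → ZMod p)) :=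
    MonoidHom.mk' (fun f => e.symm.trans (f.trans e)) (fun f f' => by ext; simp)
  have hΘ : Function.Injective Θ := by
    intro f f' h
    ext w
    have := LinearEquiv.congr_fun h (e w)
    simpa [Θ] using this
  have hlift {q : ℕ} (hq : q.Prime) (hqp : ¬ q ∣ p - 1) {f : W ≃ₗ[ZMod p] W}
      (hf : orderOf f = q) : ∃ A : SpecialLinearGroup (Fin n) (ZMod p),
        toLin' A = Θ f ∧ orderOf A = q := by
    obtain ⟨A, hA⟩ := exists_toLin'_eq (g := Θ f) hq.ne_zero
      ((Nat.Prime.coprime_iff_not_dvd hq).2 hqp)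
      (by rw [← map_pow, ← hf, pow_orderOf_eq_one, map_one])
    exact ⟨A, hA, by rw [← orderOf_injective toLin' toLin'_injective, hA, orderOf_injective Θ hΘ, hf]⟩
  obtain ⟨A, hA, hAr⟩ := hlift hr hrp hx
  obtain ⟨B, hB, hBs⟩ := hlift hs hsp hg
  have hAB : B * A * B⁻¹ = A ^ k := by
    apply toLin'_injective
    rw [map_mul, map_mul, map_inv, map_pow, hA, hB, ← map_inv, ← map_mul, ← map_mul, hconj, map_pow]
  refine _root_.exists_isSolvable_mul_dvd_card hr hs hrs (x := E A) (g := E B) (k := k) ?_ ?_ ?_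
  · rw [E.orderOf_eq, hAr]
  · rw [E.orderOf_eq, hBs]
  · rw [← map_inv, ← map_mul, ← map_mul, hAB, map_pow]

end Matrix.SpecialLinearGroup

section
variable {p : ℕ} [Fact p.Prime]

theorem dvd_pow_sub_one_of_orderOf_dvd {q d : ℕ} (hd : orderOf (p : ZMod q) ∣ d) :
    q ∣ p ^ d - 1 := by
  have hpos : 1 ≤ p ^ d := Nat.one_le_pow _ _ (Fact.out : p.Prime).pos
  rw [← ZMod.natCast_eq_zero_iff, Nat.cast_sub hpos, sub_eq_zero]
  push_cast
  exact orderOf_dvd_iff_pow_eq_one.1 hd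

theorem GaloisField.exists_unit_orderOf_eq {q d : ℕ} (hq : q.Prime) (hd0 : d ≠ 0)
    (hd : orderOf (p : ZMod q) ∣ d) : ∃ u : (GaloisField p d)ˣ, orderOf u = q := by
  have := Fact.mk hq
  refine exists_prime_orderOf_dvd_card' q ?_
  rw [Nat.card_units, GaloisField.card p d hd0]
  exact dvd_pow_sub_one_of_orderOf_dvd hd

theorem toModuleAut_units_injective (F R : Type*) [CommRing F] [CommRing R] [Algebra F R] :
    Function.Injective (DistribMulAction.toModuleAut F R : Rˣ →* (R ≃ₗ[F] R)) := by
  intro u v h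
  have := LinearEquiv.congr_fun h 1
  ext
  simpa [Units.smul_def] using this

variable {n : ℕ} {P : Type*} [Group P] [Finite P]

/-- Units of prime orders in an `n`-dimensional algebra give commuting elements of `SL_n(p)`. -/
theorem exists_isSolvable_of_units (E : Matrix.SpecialLinearGroup (Fin n) (ZMod p) ≃* P)
    {R : Type*} [CommRing R] [Algebra (ZMod p) R] [Module.Finite (ZMod p) R]
    (hR : finrank (ZMod p) R = n) {r s : ℕ} (hr : r.Prime) (hs : s.Prime) (hrs : r ≠ s)
    (hrp : ¬ r ∣ p - 1) (hsp : ¬ s ∣ p - 1) {u v : Rˣ} (hu : orderOf u = r) (hv : orderOf v = s) :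
    ∃ H : Subgroup P, Group.IsSolvable H ∧ r * s ∣ Nat.card H := by
  have hinj := toModuleAut_units_injective (ZMod p) R
  refine Matrix.SpecialLinearGroup.exists_isSolvable_mul_dvd_card E hR hr hs hrs hrp hsp
    (x := DistribMulAction.toModuleAut (ZMod p) R u)
    (g := DistribMulAction.toModuleAut (ZMod p) R v) (k := 1) ?_ ?_ ?_
  · rw [orderOf_injective _ hinj, hu]
  · rw [orderOf_injective _ hinj, hv]
  · rw [← map_inv, ← map_mul, ← map_mul, mul_right_comm, mul_inv_cancel, one_mul, pow_one]

theorem exists_isSolvable_of_orderOf_dvd (E : Matrix.SpecialLinearGroup (Fin n) (ZMod p) ≃* P)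
    {r s d : ℕ} (hr : r.Prime) (hs : s.Prime) (hrs : r ≠ s) (hrp : ¬ r ∣ p - 1)
    (hsp : ¬ s ∣ p - 1) (hd0 : d ≠ 0) (hdn : d + 1 = n) (hrd : orderOf (p : ZMod r) ∣ d)
    (hsd : orderOf (p : ZMod s) ∣ d) : ∃ H : Subgroup P, Group.IsSolvable H ∧ r * s ∣ Nat.card H := by
  obtain ⟨u, hu⟩ := GaloisField.exists_unit_orderOf_eq hr hd0 hrd
  obtain ⟨v, hv⟩ := GaloisField.exists_unit_orderOf_eq hs hd0 hsd
  refine exists_isSolvable_of_units E (R := GaloisField p d × ZMod p) ?_ hr hs hrs hrp hsp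
    (u := MulEquiv.prodUnits.symm (u, 1)) (v := MulEquiv.prodUnits.symm (v, 1)) ?_ ?_
  · rw [finrank_prod, GaloisField.finrank p hd0, finrank_self, hdn]
  · rw [MulEquiv.orderOf_eq, Prod.orderOf_mk, orderOf_one, Nat.lcm_one_right, hu]
  · rw [MulEquiv.orderOf_eq, Prod.orderOf_mk, orderOf_one, Nat.lcm_one_right, hv]

theorem exists_isSolvable_of_orderOf_add_le
    (E : Matrix.SpecialLinearGroup (Fin n) (ZMod p) ≃* P)
    {r s : ℕ} (hr : r.Prime) (hs : s.Prime) (hrs : r ≠ s) (hrp : ¬ r ∣ p - 1)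
    (hsp : ¬ s ∣ p - 1) (hr0 : orderOf (p : ZMod r) ≠ 0) (hs0 : orderOf (p : ZMod s) ≠ 0)
    (hle : orderOf (p : ZMod r) + orderOf (p : ZMod s) ≤ n) :
    ∃ H : Subgroup P, Group.IsSolvable H ∧ r * s ∣ Nat.card H := by
  obtain ⟨c, hc⟩ := Nat.exists_eq_add_of_le hle
  obtain ⟨u, hu⟩ := GaloisField.exists_unit_orderOf_eq hr hr0 dvd_rfl
  obtain ⟨v, hv⟩ := GaloisField.exists_unit_orderOf_eq hs hs0 dvd_rfl
  refine exists_isSolvable_of_units E (R := (GaloisField p (orderOf (p : ZMod r)) ×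
    GaloisField p (orderOf (p : ZMod s))) × (Fin c → ZMod p)) ?_ hr hs hrs hrp hsp
    (u := MulEquiv.prodUnits.symm (MulEquiv.prodUnits.symm (u, 1), 1))
    (v := MulEquiv.prodUnits.symm (MulEquiv.prodUnits.symm (1, v), 1)) ?_ ?_
  · rw [finrank_prod, finrank_prod, GaloisField.finrank p hr0, GaloisField.finrank p hs0,
      finrank_fin_fun, hc]
  · rw [MulEquiv.orderOf_eq, Prod.orderOf_mk, orderOf_one, Nat.lcm_one_right,
      MulEquiv.orderOf_eq, Prod.orderOf_mk, orderOf_one, Nat.lcm_one_right, hu]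
  · rw [MulEquiv.orderOf_eq, Prod.orderOf_mk, orderOf_one, Nat.lcm_one_right,
      MulEquiv.orderOf_eq, Prod.orderOf_mk, orderOf_one, Nat.lcm_one_left, hv]

/-- The normalizer of a Singer cycle. -/
theorem exists_isSolvable_of_frobenius (E : Matrix.SpecialLinearGroup (Fin n) (ZMod p) ≃* P)
    {r : ℕ} (hr : r.Prime) (hn : n.Prime) (hrn : r ≠ n) (hrp : ¬ r ∣ p - 1)
    (hnp : ¬ n ∣ p - 1) (hord : orderOf (p : ZMod r) ∣ n) :
    ∃ H : Subgroup P, Group.IsSolvable H ∧ r * n ∣ Nat.card H := by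
  obtain ⟨u, hu⟩ := GaloisField.exists_unit_orderOf_eq hr hn.ne_zero hord
  have hfin := GaloisField.finrank p hn.ne_zero
  let τ : (GaloisField p n ≃ₐ[ZMod p] GaloisField p n) →*
      (GaloisField p n ≃ₗ[ZMod p] GaloisField p n) :=
    MonoidHom.mk' AlgEquiv.toLinearEquiv (fun _ _ => rfl)
  have hτ : Function.Injective τ := AlgEquiv.toLinearEquiv_injective
  have hinj := toModuleAut_units_injective (ZMod p) (GaloisField p n)
  refine Matrix.SpecialLinearGroup.exists_isSolvable_mul_dvd_card E hfin hr hn hrn hrp hnp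
    (x := DistribMulAction.toModuleAut (ZMod p) (GaloisField p n) u)
    (g := τ (FiniteField.frobeniusAlgEquivOfAlgebraic (ZMod p) (GaloisField p n))) (k := p) ?_ ?_ ?_
  · rw [orderOf_injective _ hinj, hu]
  · rw [orderOf_injective _ hτ, FiniteField.orderOf_frobeniusAlgEquivOfAlgebraic, hfin]
  · rw [mul_inv_eq_iff_eq_mul, ← map_pow]
    ext w
    change ((u : GaloisField p n) * w) ^ Fintype.card (ZMod p) =
      ((u ^ p : (GaloisField p n)ˣ) : GaloisField p n) * w ^ Fintype.card (ZMod p)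
    rw [ZMod.card, mul_pow, Units.val_pow_eq_pow_val]
end

section
variable {p : ℕ} [Fact p.Prime] {V : Type*} [AddCommGroup V] [Module (ZMod p) V]
  [Module.Finite (ZMod p) V] {G : Type*} [Group G] [Finite G]

/-- Constraints on a linear group having a solvable subgroup of order divisible by primes `r` and
`s`, when the order of `p` modulo `r` exceeds half of the dimension. -/
theorem orderOf_constraints_of_isSolvable {φ : G →* (V ≃ₗ[ZMod p] V)}
    (hφ : Function.Injective φ) {r s : ℕ} (hr : r.Prime) (hs : s.Prime) (hrs : r ≠ s)
    (hrp : r ≠ p) (hsp : s ≠ p) (hj : finrank (ZMod p) V < 2 * orderOf (p : ZMod r))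
    {H : Subgroup G} (hH : Group.IsSolvable H) (hd : r * s ∣ Nat.card H) :
    s ∣ orderOf (p : ZMod r) ∨
      orderOf (p : ZMod s) + orderOf (p : ZMod r) ≤ finrank (ZMod p) V ∨
      orderOf (p : ZMod s) ∣ orderOf (p : ZMod r) ∨
      ∃ e, 0 < e ∧ e ≤ finrank (ZMod p) V ∧ orderOf (p : ZMod s) ∣ e ∧
        (e + orderOf (p : ZMod r) ≤ finrank (ZMod p) V ∨ orderOf (p : ZMod r) ≤ e) := by
  rcases exists_pGroup_normalized_of_isSolvable hφ hr hs hrs hH hd with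
    ⟨N, g, hN, hN1, hg, hgo⟩ | ⟨N, g, hN, hN1, hg, hgo⟩
  · rcases dvd_or_le_or_dvd_of_mem_normalizer hr hs hrp hsp hj hN hN1 hg hgo with h | h | h
    · exact Or.inl h
    · exact Or.inr (Or.inl h)
    · exact Or.inr (Or.inr (Or.inl h))
  · exact Or.inr (Or.inr (Or.inr
      (exists_dvd_of_normalized_by_large hr hs hrp hsp hj hN hN1 hg hgo)))

theorem dvd_or_dvd_of_isSolvable {φ : G →* (V ≃ₗ[ZMod p] V)}
    (hφ : Function.Injective φ) {r s : ℕ} (hr : r.Prime) (hs : s.Prime) (hrs : r ≠ s)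
    (hrp : r ≠ p) (hsp : s ≠ p) (hjr : finrank (ZMod p) V < 2 * orderOf (p : ZMod r))
    (hjs : finrank (ZMod p) V < 2 * orderOf (p : ZMod s))
    {H : Subgroup G} (hH : Group.IsSolvable H) (hd : r * s ∣ Nat.card H) :
    s ∣ orderOf (p : ZMod r) ∨ orderOf (p : ZMod s) ∣ orderOf (p : ZMod r) ∨
      r ∣ orderOf (p : ZMod s) ∨ orderOf (p : ZMod r) ∣ orderOf (p : ZMod s) := by
  rcases exists_pGroup_normalized_of_isSolvable hφ hr hs hrs hH hd with
    ⟨N, g, hN, hN1, hg, hgo⟩ | ⟨N, g, hN, hN1, hg, hgo⟩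
  · rcases dvd_or_le_or_dvd_of_mem_normalizer hr hs hrp hsp hjr hN hN1 hg hgo with h | h | h
    · exact Or.inl h
    · omega
    · exact Or.inr (Or.inl h)
  · rcases dvd_or_le_or_dvd_of_mem_normalizer hs hr hsp hrp hjs hN hN1 hg hgo with h | h | h
    · exact Or.inr (Or.inr (Or.inl h))
    · omega
    · exact Or.inr (Or.inr (Or.inr h))
end

section
variable {p q d : ℕ}

theorem ne_of_two_le_orderOf (hq : q.Prime) (hd : 2 ≤ orderOf (p : ZMod q)) : q ≠ p := by
  rintro rfl
  have := Fact.mk hq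
  have h0 : ((q : ZMod q)) ^ orderOf (q : ZMod q) = 1 := pow_orderOf_eq_one _
  rw [ZMod.natCast_self, zero_pow] at h0
  · exact zero_ne_one h0
  · rw [← ZMod.natCast_self q]; omega

theorem not_dvd_sub_one_of_two_le_orderOf (hp : p.Prime) (hd : 2 ≤ orderOf (p : ZMod q)) :
    ¬ q ∣ p - 1 := by
  intro h
  have h1 : (p : ZMod q) = 1 := by
    rw [← ZMod.natCast_eq_zero_iff, Nat.cast_sub hp.one_lt.le, sub_eq_zero] at h
    simpa using h
  rw [h1, orderOf_one] at hd
  omega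

theorem exists_eq_orderOf_mul_add_one (hq : q.Prime) (hp : p.Prime)
    (hd : 2 ≤ orderOf (p : ZMod q)) : ∃ c, 0 < c ∧ q = orderOf (p : ZMod q) * c + 1 := by
  have := Fact.mk hq
  have hp0 : (p : ZMod q) ≠ 0 := by
    rw [Ne, ZMod.natCast_eq_zero_iff, Nat.prime_dvd_prime_iff_eq hq hp]
    exact ne_of_two_le_orderOf hq hd
  obtain ⟨c, hc⟩ := ZMod.orderOf_dvd_card_sub_one hp0
  have := hq.two_le
  refine ⟨c, Nat.pos_of_ne_zero ?_, by omega⟩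
  rintro rfl
  omega
end

end Constructions

/-- if `p` and `n` are primes, `n > 13`, and `p` is a primitive
root modulo `n`, then the compact form of the solvable graph of `PSL_n(p)` is
not split. -/
theorem compactForm_solvableGraph_psl_not_split (p n : ℕ) (hp : p.Prime) (hn : n.Prime)
    (h13 : 13 < n) (hord : orderOf (p : ZMod n) = n - 1) :
    ¬ (compactForm
        (solvableGraphOn (Matrix.ProjectiveSpecialLinearGroup (Fin n) (ZMod p)))).IsSplit
      Set.univ := by
  have := Fact.mk hp
  obtain ⟨k, rfl⟩ : ∃ k, n = 2 * k + 17 := by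
    have h1 := hn.eq_two_or_odd
    have h2 : n ≠ 15 := by rintro rfl; norm_num at hn
    exact ⟨(n - 17) / 2, by omega⟩
  have on : orderOf (p : ZMod (2 * k + 17)) = 2 * k + 16 := by omega
  have hexc : ¬ (p = 2 ∧ k + 6 = 6) := by
    rintro ⟨rfl, hk⟩
    obtain rfl : k = 0 := by omega
    have h1 : orderOf ((2 : ℕ) : ZMod (2 * 0 + 17)) ∣ 8 :=
      orderOf_dvd_of_pow_eq_one (by decide)
    rw [on] at h1
    norm_num at h1
  obtain ⟨rn, hrn, on'⟩ := exists_prime_orderOf_eq (i := 2 * k + 17) hp.two_le (by omega) (by omega)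
  obtain ⟨rm, hrm, om⟩ := exists_prime_orderOf_eq (i := k + 8) hp.two_le (by omega) (by omega)
  obtain ⟨ri, hri, oi⟩ := exists_prime_orderOf_eq (i := k + 6) hp.two_le (by omega) hexc
  obtain ⟨rj, hrj, oj⟩ := exists_prime_orderOf_eq (i := k + 9) hp.two_le (by omega) (by omega)
  obtain ⟨rk, hrk, ok⟩ := exists_prime_orderOf_eq (i := k + 11) hp.two_le (by omega) (by omega)
  have hne {r s : ℕ} (h : orderOf (p : ZMod r) ≠ orderOf (p : ZMod s)) : r ≠ s := by
    rintro rfl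
    exact h rfl
  have hnp := not_dvd_sub_one_of_two_le_orderOf (q := 2 * k + 17) hp (by omega)
  let G := Matrix.ProjectiveSpecialLinearGroup (Fin (2 * k + 17)) (ZMod p)
  have hbot := Matrix.SpecialLinearGroup.center_eq_bot_of_coprime hn.ne_zero
    ((Nat.Prime.coprime_iff_not_dvd hn).2 hnp)
  let E : Matrix.SpecialLinearGroup (Fin (2 * k + 17)) (ZMod p) ≃* G :=
    MulEquiv.ofBijective (QuotientGroup.mk' _)
      ⟨(MonoidHom.ker_eq_bot_iff _).1 (by rw [QuotientGroup.ker_mk', hbot]),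
        QuotientGroup.mk'_surjective _⟩
  let φ : G →* ((Fin (2 * k + 17) → ZMod p) ≃ₗ[ZMod p] (Fin (2 * k + 17) → ZMod p)) :=
    Matrix.SpecialLinearGroup.toLin'.comp E.symm.toMonoidHom
  have hφ : Function.Injective φ :=
    Matrix.SpecialLinearGroup.toLin'_injective.comp E.symm.injective
  have hfin : Module.finrank (ZMod p) (Fin (2 * k + 17) → ZMod p) = 2 * k + 17 :=
    Module.finrank_fin_fun _
  -- solvable subgroups realizing the edges
  have eab : ∃ H : Subgroup G, Group.IsSolvable H ∧ rn * (2 * k + 17) ∣ Nat.card H :=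
    exists_isSolvable_of_frobenius E hrn hn (hne (by omega))
      (not_dvd_sub_one_of_two_le_orderOf hp (by omega)) hnp (by rw [on'])
  have eae : ∃ H : Subgroup G, Group.IsSolvable H ∧ (2 * k + 17) * rm ∣ Nat.card H :=
    exists_isSolvable_of_orderOf_dvd E (d := 2 * k + 16) hn hrm (hne (by omega)) hnp
      (not_dvd_sub_one_of_two_le_orderOf hp (by omega)) (by omega) rfl (by rw [on])
      (by rw [om]; exact ⟨2, by ring⟩)
  have ecd : ∃ H : Subgroup G, Group.IsSolvable H ∧ ri * rj ∣ Nat.card H :=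
    exists_isSolvable_of_orderOf_add_le E hri hrj (hne (by omega))
      (not_dvd_sub_one_of_two_le_orderOf hp (by omega))
      (not_dvd_sub_one_of_two_le_orderOf hp (by omega)) (by omega) (by omega) (by omega)
  have ecf : ∃ H : Subgroup G, Group.IsSolvable H ∧ ri * rk ∣ Nat.card H :=
    exists_isSolvable_of_orderOf_add_le E hri hrk (hne (by omega))
      (not_dvd_sub_one_of_two_le_orderOf hp (by omega))
      (not_dvd_sub_one_of_two_le_orderOf hp (by omega)) (by omega) (by omega) (by omega)
  have hvert {r s : ℕ} (h : ∃ H : Subgroup G, Group.IsSolvable H ∧ r * s ∣ Nat.card H) :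
      r ∣ Nat.card G ∧ s ∣ Nat.card G := by
    obtain ⟨H, -, hH⟩ := h
    exact ⟨((Dvd.intro _ rfl).trans hH).trans (Subgroup.card_subgroup_dvd_card H),
      ((Dvd.intro_left _ rfl).trans hH).trans (Subgroup.card_subgroup_dvd_card H)⟩
  -- non-edges
  have hdn {d : ℕ} (hd : d ∣ 2 * k + 17) (h1 : d ≠ 1) (h2 : d ≠ 2 * k + 17) : False :=
    ((Nat.dvd_prime hn).1 hd).elim h1 h2
  have nb {s : ℕ} (hs : s.Prime) (h6 : 6 ≤ orderOf (p : ZMod s))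
      (hlt : orderOf (p : ZMod s) < 2 * k + 16) (H : Subgroup G) (hH : Group.IsSolvable H) :
      ¬ rn * s ∣ Nat.card H := by
    intro hd
    have hsn : s ≠ 2 * k + 17 := hne (by omega)
    rcases orderOf_constraints_of_isSolvable hφ hrn hs (hne (by omega))
      (ne_of_two_le_orderOf hrn (by omega)) (ne_of_two_le_orderOf hs (by omega)) (by omega) hH hd
      with h | h | h | ⟨e, h0, hle, hde, h⟩
    · rw [on'] at h
      exact hdn h hs.ne_one hsn
    · omega
    · rw [on'] at h
      exact hdn h (by omega) (by omega)
    · obtain rfl : e = 2 * k + 17 := by omega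
      exact hdn hde (by omega) (by omega)
  have na {s : ℕ} (hs : s.Prime) (h6 : 6 ≤ orderOf (p : ZMod s))
      (hlt : orderOf (p : ZMod s) < 2 * k + 16) (hs1 : ¬ s ∣ 2 * k + 16)
      (hs2 : ¬ orderOf (p : ZMod s) ∣ 2 * k + 16) (H : Subgroup G) (hH : Group.IsSolvable H) :
      ¬ (2 * k + 17) * s ∣ Nat.card H := by
    intro hd
    rcases orderOf_constraints_of_isSolvable hφ hn hs (hne (by omega))
      (ne_of_two_le_orderOf hn (by omega)) (ne_of_two_le_orderOf hs (by omega)) (by omega) hH hd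
      with h | h | h | ⟨e, h0, hle, hde, h⟩
    · rw [on] at h
      exact hs1 h
    · omega
    · rw [on] at h
      exact hs2 h
    · obtain rfl | rfl | rfl : e = 1 ∨ e = 2 * k + 16 ∨ e = 2 * k + 17 := by omega
      · have := Nat.dvd_one.1 hde
        omega
      · exact hs2 hde
      · exact hdn hde (by omega) (by omega)
  obtain ⟨ci, hci, hri'⟩ := exists_eq_orderOf_mul_add_one hri hp (by omega)
  obtain ⟨cj, hcj, hrj'⟩ := exists_eq_orderOf_mul_add_one hrj hp (by omega)
  obtain ⟨ck, hck, hrk'⟩ := exists_eq_orderOf_mul_add_one hrk hp (by omega)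
  have hri3 : ri = k + 7 ∨ ri = 2 * k + 13 ∨ 3 * k + 19 ≤ ri := by
    rw [oi] at hri'
    rcases ci with _ | _ | _ | c
    · omega
    · omega
    · omega
    · exact Or.inr (Or.inr (by nlinarith))
  have hrj2 : rj = k + 10 ∨ 2 * k + 19 ≤ rj := by
    rw [oj] at hrj'
    rcases cj with _ | _ | c
    · omega
    · omega
    · exact Or.inr (by nlinarith)
  have hrk1 : k + 12 ≤ rk := by
    rw [ok] at hrk'
    nlinarith
  have nac := na hri (by omega) (by omega)
    (by
      rcases hri3 with h | h | h
      · exact Nat.not_dvd_of_lt_of_lt_mul_succ (k := 2) (by omega) (by omega)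
      · exact Nat.not_dvd_of_lt_of_lt_mul_succ (k := 1) (by omega) (by omega)
      · exact Nat.not_dvd_of_lt_of_lt_mul_succ (k := 0) (by omega) (by omega))
    (by
      rw [oi]
      exact Nat.not_dvd_of_lt_of_lt_mul_succ (k := 2) (by omega) (by omega))
  have nad := na hrj (by omega) (by omega)
    (by
      rcases hrj2 with h | h
      · exact Nat.not_dvd_of_lt_of_lt_mul_succ (k := 1) (by omega) (by omega)
      · exact Nat.not_dvd_of_lt_of_lt_mul_succ (k := 0) (by omega) (by omega))
    (by
      rw [oj]
      exact Nat.not_dvd_of_lt_of_lt_mul_succ (k := 1) (by omega) (by omega))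
  have ndf (H : Subgroup G) (hH : Group.IsSolvable H) : ¬ rj * rk ∣ Nat.card H := by
    intro hd
    rcases dvd_or_dvd_of_isSolvable hφ hrj hrk (hne (by omega))
      (ne_of_two_le_orderOf hrj (by omega)) (ne_of_two_le_orderOf hrk (by omega)) (by omega)
      (by omega) hH hd with h | h | h | h
    · have := Nat.le_of_dvd (by omega) h
      omega
    · have := Nat.le_of_dvd (by omega) h
      omega
    · rw [ok] at h
      rcases hrj2 with h' | h'
      · exact Nat.not_dvd_of_lt_of_lt_mul_succ (k := 1) (by omega) (by omega) h
      · exact Nat.not_dvd_of_lt_of_lt_mul_succ (k := 0) (by omega) (by omega) h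
    · rw [oj, ok] at h
      exact Nat.not_dvd_of_lt_of_lt_mul_succ (k := 1) (by omega) (by omega) h
  have hnadj {r s : {r : ℕ // r.Prime ∧ r ∣ Nat.card G}}
      (h : ∀ H : Subgroup G, Group.IsSolvable H → ¬ r.1 * s.1 ∣ Nat.card H) :
      ¬ (solvableGraphOn G).Adj r s := fun ⟨_, H, hH, hd⟩ => h H hH hd
  have hadj {r s : {r : ℕ // r.Prime ∧ r ∣ Nat.card G}} (hrs : r.1 ≠ s.1)
      (h : ∃ H : Subgroup G, Group.IsSolvable H ∧ r.1 * s.1 ∣ Nat.card H) :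
      (solvableGraphOn G).Adj r s := ⟨fun h' => hrs (congrArg Subtype.val h'), h⟩
  have hvne {r s : {r : ℕ // r.Prime ∧ r ∣ Nat.card G}} (hrs : r.1 ≠ s.1) : r ≠ s :=
    fun h' => hrs (congrArg Subtype.val h')
  exact not_isSplit_compactForm
    (a := ⟨2 * k + 17, hn, (hvert eab).2⟩) (b := ⟨rn, hrn, (hvert eab).1⟩)
    (c := ⟨ri, hri, (hvert ecd).1⟩) (d := ⟨rj, hrj, (hvert ecd).2⟩)
    (e := ⟨rm, hrm, (hvert eae).2⟩) (f := ⟨rk, hrk, (hvert ecf).2⟩)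
    (hadj (hne (by omega)) (by simpa only [mul_comm] using eab)) (hadj (hne (by omega)) ecd)
    (hadj (hne (by omega)) eae) (hnadj (nb hrm (by omega) (by omega))) (hvne (hne (by omega)))
    (hadj (hne (by omega)) ecf) (hnadj ndf) (hvne (hne (by omega))) (hnadj nac) (hnadj nad)
    (hnadj (nb hri (by omega) (by omega))) (hnadj (nb hrj (by omega) (by omega)))
    (hvne (hne (by omega))) (hvne (hne (by omega))) (hvne (hne (by omega)))
    (hvne (hne (by omega)))
end

section
/- The compact form S_c(PSL_11(2)) of the solvable graph of the group PSL_11(2) is not a split graph; in particular, the solvable graph S(PSL_11(2)) contains four primes inducing a subgraph isomorphic to 2K₂ (two disjoint edges) whose closed neighborhoods in S(PSL_11(2)) are pairwise distinct. -/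
/-- A self-map whose `p`-th iterate is the identity has, modulo `p`, as many fixed points as its
domain has points. -/
theorem card_modEq_card_fixedPoints_of_iterate_eq_id {α : Type*} [Finite α] {p : ℕ}
    [Fact p.Prime] {f : α → α} (hf : f^[p] = id) :
    Nat.card α ≡ Nat.card (Function.fixedPoints f) [MOD p] := by
  classical
  have := Fintype.ofFinite α
  have hend : (show Function.End α from f) ^ p ^ 1 = 1 := by
    rw [pow_one]
    exact (hom_coe_pow (fun g : Function.End α => g) rfl (fun _ _ => rfl) f p).trans hf
  have := Equiv.Perm.card_fixedPoints_modEq hend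
  rwa [← Nat.card_eq_fintype_card, ← Nat.card_eq_fintype_card] at this

/-- An element of order `q` normalizing a finite `p`-group `P` with `|P| ≢ 1 (mod q)` centralizes
an element of order `p`. -/
theorem exists_orderOf_eq_commute_of_mem_normalizer {G : Type*} [Group G] [Finite G] {p q : ℕ}
    [Fact p.Prime] [Fact q.Prime] {P : Subgroup G} (hP : IsPGroup p P)
    (hmod : ¬ Nat.card P ≡ 1 [MOD q]) {y : G} (hy : orderOf y = q)
    (hyP : y ∈ Subgroup.normalizer (P : Set G)) :
    ∃ x : G, orderOf x = p ∧ Commute x y := by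
  let f : P → P := fun x =>
    ⟨y * x * y⁻¹, (Subgroup.mem_normalizer_iff.mp hyP x).mp x.2⟩
  have hiter (n : ℕ) (x : P) : ((f^[n] x : P) : G) = y ^ n * x * (y ^ n)⁻¹ := by
    induction n with
    | zero => simp
    | succ n ih =>
      rw [Function.iterate_succ_apply']
      change y * (f^[n] x : G) * y⁻¹ = _
      rw [ih]
      group
  have hf : f^[q] = id := by
    funext x
    apply Subtype.ext
    rw [hiter, ← hy, pow_orderOf_eq_one]
    simp
  have hcard := card_modEq_card_fixedPoints_of_iterate_eq_id hf
  obtain ⟨x, hx, hx1⟩ : ∃ x : P, f x = x ∧ x ≠ 1 := by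
    by_contra! h
    refine hmod ?_
    have h1 : Nat.card (Function.fixedPoints f) = 1 := by
      refine Nat.card_eq_one_iff_exists.mpr ⟨⟨1, ?_⟩, fun z => Subtype.ext (h z z.2)⟩
      exact Subtype.ext (by simp [f])
    rwa [h1] at hcard
  have hcomm : Commute (x : G) y := (mul_inv_eq_iff_eq_mul.mp (congrArg Subtype.val hx)).symm
  obtain ⟨k, hk⟩ := IsPGroup.iff_orderOf.mp hP x
  have hk0 : k ≠ 0 := by
    rintro rfl
    exact hx1 (orderOf_eq_one_iff.mp (by simpa using hk))
  have hdvd : p ∣ orderOf (x : G) := by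
    rw [Subgroup.orderOf_coe, hk]
    exact dvd_pow_self p hk0
  refine ⟨(x : G) ^ (orderOf (x : G) / p), ?_, hcomm.pow_left _⟩
  exact orderOf_pow_orderOf_div (orderOf_pos _).ne' hdvd

/-- A nontrivial finite solvable group has a normal subgroup of prime index. -/
theorem exists_normal_index_prime (G : Type*) [Group G] [Finite G] [Group.IsSolvable G]
    [Nontrivial G] : ∃ N : Subgroup G, N.Normal ∧ N.index.Prime := by
  obtain h | ⟨N, hN, hle⟩ := eq_top_or_exists_le_coatom (commutator G)
  · exact absurd h (Group.IsSolvable.commutator_lt_top_of_nontrivial G).ne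
  have hnormal : N.Normal := Subgroup.Normal.of_commutator_le G hle
  refine ⟨N, hnormal, ?_⟩
  have hidx : Nat.card (G ⧸ N) ≠ 1 := fun h => hN.1 (Subgroup.index_eq_one.mp h)
  obtain ⟨r, hr, hdvd⟩ := Nat.exists_prime_and_dvd hidx
  have := Fact.mk hr
  obtain ⟨g, hg⟩ := exists_prime_orderOf_dvd_card' r hdvd
  have hlt : N < (Subgroup.zpowers g).comap (QuotientGroup.mk' N) := by
    refine lt_of_le_of_ne ?_ fun h => ?_
    · intro n hn
      have : QuotientGroup.mk' N n = 1 := (QuotientGroup.eq_one_iff n).mpr hn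
      simp only [Subgroup.mem_comap, this, one_mem]
    · obtain ⟨a, rfl⟩ := QuotientGroup.mk'_surjective N g
      have ha : a ∈ N := by
        rw [h]
        exact Subgroup.mem_zpowers _
      have h1 : QuotientGroup.mk' N a = 1 := (QuotientGroup.eq_one_iff a).mpr ha
      rw [h1, orderOf_one] at hg
      exact hr.one_lt.ne hg
  have htop : Subgroup.zpowers g = ⊤ :=
    Subgroup.comap_injective (QuotientGroup.mk'_surjective N) (hN.2 _ hlt)
  rw [Subgroup.index, ← Subgroup.card_top, ← htop, Nat.card_zpowers, hg]
  exact hr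

/-- If `N` is a normal subgroup of prime index `q` whose order is divisible by the prime `p`, and no
nontrivial power of `p` dividing `|G|` is `1` modulo `q`, then `G` has commuting elements of orders
`p` and `q`: by the Frattini argument an element of order `q` normalizes a Sylow `p`-subgroup of
`N`. -/
theorem exists_commute_orderOf_of_index_eq {G : Type*} [Group G] [Finite G] {p q : ℕ}
    [Fact p.Prime] [Fact q.Prime] (hmod : ∀ a, a ≠ 0 → p ^ a ∣ Nat.card G → ¬ p ^ a ≡ 1 [MOD q])
    {N : Subgroup G} [N.Normal] (hq : N.index = q) (hp : p ∣ Nat.card N) :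
    ∃ x y : G, orderOf x = p ∧ orderOf y = q ∧ Commute x y := by
  let P : Sylow p N := default
  set Q : Subgroup G := (P : Subgroup N).map N.subtype with hQ
  have hfrattini := P.normalizer_sup_eq_top
  have hcardQ : Nat.card Q = Nat.card P :=
    Subgroup.card_map_of_injective N.subtype_injective
  have hdvd : q ∣ Nat.card (Subgroup.normalizer (Q : Set G)) := by
    have := Subgroup.relIndex_sup_right (Subgroup.normalizer (Q : Set G)) N
    rw [hfrattini, Subgroup.relIndex_top_right, hq] at this
    rw [this]
    exact Subgroup.relIndex_dvd_card _ _
  obtain ⟨y, hy⟩ := exists_prime_orderOf_dvd_card' q hdvd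
  have hQp : IsPGroup p Q := P.isPGroup'.map _
  obtain ⟨a, ha⟩ := IsPGroup.iff_card.mp hQp
  have ha0 : a ≠ 0 := by
    rintro rfl
    have := P.dvd_card_of_dvd_card hp
    rw [← hcardQ, ha, pow_zero] at this
    exact (Fact.out : p.Prime).one_lt.ne' (Nat.dvd_one.mp this)
  have hy' : orderOf (y : G) = q := by rwa [Subgroup.orderOf_coe]
  obtain ⟨x, hx, hxy⟩ := exists_orderOf_eq_commute_of_mem_normalizer hQp
    (ha ▸ hmod a ha0 (ha ▸ Q.card_subgroup_dvd_card)) hy' y.2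
  exact ⟨x, y, hx, hy', hxy⟩

/-- A finite solvable group whose order is divisible by the primes `p` and `q` has commuting
elements of orders `p` and `q`, unless a nontrivial power of one of them dividing the order is `1`
modulo the other. -/
theorem exists_commute_orderOf_of_isSolvable {p q : ℕ} (hp : p.Prime) (hq : q.Prime) (hpq : p ≠ q)
    {G : Type*} [Group G] [Finite G] [Group.IsSolvable G]
    (hpG : p ∣ Nat.card G) (hqG : q ∣ Nat.card G)
    (hmodp : ∀ a, a ≠ 0 → p ^ a ∣ Nat.card G → ¬ p ^ a ≡ 1 [MOD q])
    (hmodq : ∀ a, a ≠ 0 → q ^ a ∣ Nat.card G → ¬ q ^ a ≡ 1 [MOD p]) :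
    ∃ x y : G, orderOf x = p ∧ orderOf y = q ∧ Commute x y := by
  have := Fact.mk hp
  have := Fact.mk hq
  induction hn : Nat.card G using Nat.strong_induction_on generalizing G with
  | _ n ih =>
  have : Nontrivial G := by
    refine Finite.one_lt_card_iff_nontrivial.mp ?_
    exact hp.one_lt.trans_le (Nat.le_of_dvd Nat.card_pos hpG)
  obtain ⟨N, hN, hidx⟩ := exists_normal_index_prime G
  have hmul := N.card_mul_index
  have hdvd {r : ℕ} (hr : r.Prime) (hrG : r ∣ Nat.card G) (hne : N.index ≠ r) :
      r ∣ Nat.card N := by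
    rw [← hmul] at hrG
    exact (hr.dvd_mul.mp hrG).resolve_right fun h =>
      hne ((Nat.prime_dvd_prime_iff_eq hr hidx).mp h).symm
  by_cases hq' : N.index = q
  · exact exists_commute_orderOf_of_index_eq hmodp hq' (hdvd hp hpG fun h => hpq (h.symm.trans hq'))
  by_cases hp' : N.index = p
  · obtain ⟨x, y, hx, hy, hxy⟩ :=
      exists_commute_orderOf_of_index_eq hmodq hp' (hdvd hq hqG hq')
    exact ⟨y, x, hy, hx, hxy.symm⟩
  have hlt : Nat.card N < n := by
    rw [← hn, ← hmul]
    exact lt_mul_of_one_lt_right Nat.card_pos hidx.one_lt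
  obtain ⟨x, y, hx, hy, hxy⟩ := ih (Nat.card N) hlt (hdvd hp hpG hp') (hdvd hq hqG hq')
    (fun a ha h => hmodp a ha (h.trans N.card_subgroup_dvd_card))
    (fun a ha h => hmodq a ha (h.trans N.card_subgroup_dvd_card)) rfl
  exact ⟨x, y, by rwa [Subgroup.orderOf_coe], by rwa [Subgroup.orderOf_coe],
    congrArg Subtype.val hxy⟩

open Module in
/-- On an invariant subspace `W` of a finite vector space, an endomorphism of order dividing `p`
fixes, modulo `p`, as many vectors as `W` has. -/
theorem pow_finrank_modEq_pow_finrank_inf_ker {K V : Type*} [Field K] [Finite K] [AddCommGroup V]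
    [Module K V] [Module.Finite K V] {p : ℕ} [Fact p.Prime] {f : Module.End K V} (hf : f ^ p = 1)
    {W : Submodule K V} (hW : ∀ w ∈ W, f w ∈ W) :
    Nat.card K ^ finrank K W ≡ Nat.card K ^ finrank K ↥(W ⊓ LinearMap.ker (f - 1)) [MOD p] := by
  have : Finite V := Module.finite_of_finite K
  let g : W → W := fun w => ⟨f w, hW w w.2⟩
  have hg (n : ℕ) (w : W) : ((g^[n] w : W) : V) = (f ^ n) w := by
    induction n with
    | zero => simp
    | succ n ih =>
      rw [Function.iterate_succ_apply', pow_succ', Module.End.mul_apply, ← ih]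
  have hgp : g^[p] = id := by
    funext w
    apply Subtype.ext
    rw [hg, hf]
    rfl
  have hcard := card_modEq_card_fixedPoints_of_iterate_eq_id hgp
  let e : Function.fixedPoints g ≃ ↥(W ⊓ LinearMap.ker (f - 1)) :=
    { toFun w := ⟨w.1, w.1.2, by
        have hw : f w.1 = w.1 := congrArg Subtype.val w.2
        simpa [sub_eq_zero] using hw⟩
      invFun w := ⟨⟨w.1, w.2.1⟩, Subtype.ext (by
        simpa [sub_eq_zero] using w.2.2)⟩
      left_inv _ := rfl
      right_inv _ := rfl }
  rwa [Nat.card_congr e, Module.natCard_eq_pow_finrank (K := K) (V := W),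
    Module.natCard_eq_pow_finrank (K := K) (V := ↥(W ⊓ LinearMap.ker (f - 1)))] at hcard

open Module in
/-- Congruences between the dimensions `a`, `b`, `c` of the fixed spaces of `x`, of `y` and of both,
for commuting elements `x`, `y` of prime orders `p`, `q` of a finite general linear group. -/
theorem exists_fixed_dimensions_of_commute {K V : Type*} [Field K] [Finite K]
    [AddCommGroup V] [Module K V] [Module.Finite K V] {p q : ℕ} [hp : Fact p.Prime]
    [hq : Fact q.Prime] {x y : LinearMap.GeneralLinearGroup K V} (hx : orderOf x = p)
    (hy : orderOf y = q) (hxy : Commute x y) :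
    ∃ a b c : ℕ, a < finrank K V ∧ b < finrank K V ∧ c ≤ a ∧ c ≤ b ∧
      Nat.card K ^ finrank K V ≡ Nat.card K ^ a [MOD p] ∧
      Nat.card K ^ finrank K V ≡ Nat.card K ^ b [MOD q] ∧
      Nat.card K ^ a ≡ Nat.card K ^ c [MOD q] ∧
      Nat.card K ^ b ≡ Nat.card K ^ c [MOD p] := by
  have hpow {z : LinearMap.GeneralLinearGroup K V} {r : ℕ} (hz : orderOf z = r) :
      (z : Module.End K V) ^ r = 1 := by
    rw [← Units.val_pow_eq_pow_val, ← hz, pow_orderOf_eq_one, Units.val_one]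
  have hlt {z : LinearMap.GeneralLinearGroup K V} {r : ℕ} (hr : r.Prime) (hz : orderOf z = r) :
      finrank K (LinearMap.ker ((z : Module.End K V) - 1)) < finrank K V := by
    refine Submodule.finrank_lt fun h => hr.one_lt.ne' ?_
    rw [LinearMap.ker_eq_top, sub_eq_zero, Units.val_eq_one] at h
    rw [← hz, h, orderOf_one]
  have htop {z : LinearMap.GeneralLinearGroup K V} {r : ℕ} [Fact r.Prime] (hz : orderOf z = r) :
      Nat.card K ^ finrank K V ≡
        Nat.card K ^ finrank K (LinearMap.ker ((z : Module.End K V) - 1)) [MOD r] := by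
    have := pow_finrank_modEq_pow_finrank_inf_ker (hpow hz) (W := ⊤) fun _ _ => trivial
    rwa [finrank_top, top_inf_eq] at this
  have hinv {z w : LinearMap.GeneralLinearGroup K V} (h : Commute z w) :
      ∀ v ∈ LinearMap.ker ((z : Module.End K V) - 1),
        (w : Module.End K V) v ∈ LinearMap.ker ((z : Module.End K V) - 1) := by
    intro v hv
    have hzw := LinearMap.congr_fun (congrArg Units.val h.eq) v
    simp only [LinearMap.mem_ker, LinearMap.sub_apply, Module.End.one_apply, sub_eq_zero,
      Units.val_mul, Module.End.mul_apply] at hv hzw ⊢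
    rw [hzw, hv]
  refine ⟨_, _, finrank K ↥(LinearMap.ker ((x : Module.End K V) - 1) ⊓
    LinearMap.ker ((y : Module.End K V) - 1)), hlt hp.out hx, hlt hq.out hy,
    Submodule.finrank_mono inf_le_left, Submodule.finrank_mono inf_le_right, htop hx, htop hy,
    pow_finrank_modEq_pow_finrank_inf_ker (hpow hy) (hinv hxy), ?_⟩
  rw [inf_comm]
  exact pow_finrank_modEq_pow_finrank_inf_ker (hpow hx) (hinv hxy.symm)

/-- A semidirect product of solvable groups is solvable. -/
instance SemidirectProduct.isSolvable {N G : Type*} [Group N] [Group G] (φ : G →* MulAut N)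
    [Group.IsSolvable N] [Group.IsSolvable G] : Group.IsSolvable (N ⋊[φ] G) :=
  Group.isSolvable_of_ker_le_range SemidirectProduct.inl SemidirectProduct.rightHom
    SemidirectProduct.range_inl_eq_ker_rightHom.ge

open Module in
/-- If `F / K` is an extension of finite fields and `V` is a `K`-space with `dim V ≥ [F : K]`, then
the semilinear group `Fˣ ⋊ Gal(F/K)` embeds in `GL(V)`, acting on a copy of `F` inside `V`. -/
theorem exists_isSolvable_subgroup_generalLinearGroup (K F V : Type*) [Field K] [Field F]
    [Algebra K F] [Finite F] [AddCommGroup V] [Module K V] [Module.Finite K V]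
    (hV : finrank K F ≤ finrank K V) :
    ∃ H : Subgroup (LinearMap.GeneralLinearGroup K V), Group.IsSolvable H ∧
      Nat.card H = (Nat.card F - 1) * finrank K F := by
  have : Finite K := Finite.of_injective _ (algebraMap K F).injective
  let φ : Gal(F/K) →* MulAut Fˣ :=
    { toFun σ := Units.mapEquiv (σ : F ≃* F)
      map_one' := by ext; rfl
      map_mul' _ _ := by ext; rfl }
  let e : (F × (Fin (finrank K V - finrank K F) → K)) ≃ₗ[K] V :=
    LinearEquiv.ofFinrankEq _ _ (by
      rw [finrank_prod, finrank_fin_fun, Nat.add_sub_cancel' hV])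
  let ψ : Fˣ ⋊[φ] Gal(F/K) →* Module.End K F :=
    { toFun s := Algebra.lmul K F s.left * s.right.toLinearMap
      map_one' := by ext; simp
      map_mul' s t := by
        ext x
        have hφ : ((φ s.right t.left : Fˣ) : F) = s.right t.left := rfl
        simp [hφ, mul_assoc] }
  let ρ : Fˣ ⋊[φ] Gal(F/K) →* Module.End K V :=
    { toFun s := e.conj ((ψ s).prodMap 1)
      map_one' := by
        rw [map_one, LinearMap.prodMap_one]
        exact LinearEquiv.conj_id e
      map_mul' s t := by
        ext v
        simp }
  have hψ : Function.Injective ψ := by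
    intro s t h
    have happ (x : F) : (s.left : F) * s.right x = t.left * t.right x := LinearMap.congr_fun h x
    have hleft : s.left = t.left := Units.ext (by simpa using happ 1)
    refine SemidirectProduct.ext hleft (AlgEquiv.ext fun x => ?_)
    have := happ x
    rw [hleft] at this
    exact mul_left_cancel₀ t.left.ne_zero this
  have hρ : Function.Injective ρ := by
    intro s t h
    refine hψ (LinearMap.ext fun x => ?_)
    have := LinearMap.congr_fun (e.conj.injective h) (x, 0)
    exact congrArg Prod.fst this
  have hunits : Function.Injective ρ.toHomUnits := fun s t h =>
    hρ (congrArg Units.val h)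
  refine ⟨ρ.toHomUnits.range,
    Group.isSolvable_of_surjective ρ.toHomUnits.rangeRestrict_surjective, ?_⟩
  rw [← Nat.card_congr (MonoidHom.ofInjective hunits).toEquiv, SemidirectProduct.card,
    IsGalois.card_aut_eq_finrank, Nat.card_units]

/-- Over `𝔽₂` the determinant and the center impose nothing, so `PSLₙ(2)` is `GLₙ(2)`. -/
theorem nonempty_mulEquiv_psl_generalLinearGroup (n : ℕ) :
    Nonempty (Matrix.ProjectiveSpecialLinearGroup (Fin n) (ZMod 2) ≃*
      GL (Fin n) (ZMod 2)) := by
  have hone : ∀ r : ZMod 2, r ≠ 0 → r = 1 := by decide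
  have hbot : Subgroup.center (Matrix.SpecialLinearGroup (Fin n) (ZMod 2)) = ⊥ := by
    refine (Subgroup.eq_bot_iff_forall _).mpr fun A hA => ?_
    rcases n with _ | n
    · exact Subsingleton.elim _ _
    obtain ⟨r, hr, hrA⟩ := Matrix.SpecialLinearGroup.mem_center_iff.mp hA
    have hr1 : r = 1 := hone r fun h => by simp [h] at hr
    refine Subtype.ext ?_
    rw [← hrA, hr1, map_one]
    rfl
  have hbij : Function.Bijective
      (Matrix.SpecialLinearGroup.toGL : Matrix.SpecialLinearGroup (Fin n) (ZMod 2) →* _) := by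
    refine ⟨Matrix.SpecialLinearGroup.toGL_injective, fun A => ?_⟩
    refine ⟨⟨A, hone _ ?_⟩, Units.ext rfl⟩
    exact ((Matrix.isUnit_iff_isUnit_det _).mp A.isUnit).ne_zero
  exact ⟨((QuotientGroup.quotientMulEquivOfEq hbot).trans QuotientGroup.quotientBot).trans
    (MulEquiv.ofBijective _ hbij)⟩

/-- Vertices separated by a third vertex `w` have distinct closed neighborhoods. -/
theorem closedNbhd_ne_of_adj {V : Type*} {Γ : SimpleGraph V} {u v w : V} (huw : Γ.Adj u w)
    (hne : v ≠ w) (hvw : ¬ Γ.Adj v w) : closedNbhd Γ u ≠ closedNbhd Γ v := by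
  intro h
  have hw : w ∈ closedNbhd Γ v := h ▸ Set.mem_insert_of_mem u huw
  exact hw.elim (fun h => hne h.symm) hvw

/-- Distinct nonadjacent vertices have distinct closed neighborhoods. -/
theorem closedNbhd_ne_of_not_adj {V : Type*} {Γ : SimpleGraph V} {u v : V} (hne : u ≠ v)
    (huv : ¬ Γ.Adj u v) : closedNbhd Γ u ≠ closedNbhd Γ v := by
  intro h
  have hu : u ∈ closedNbhd Γ v := h ▸ Set.mem_insert u _
  exact hu.elim hne fun h => huv (Γ.symm.symm _ _ h)

/-- Distinct classes of the compact form are adjacent only if any representatives are. -/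
theorem compactForm_adj_mk {V : Type*} {Γ : SimpleGraph V} {a b : V}
    (h : (compactForm Γ).Adj (Quotient.mk (nbhdSetoid Γ) a) (Quotient.mk (nbhdSetoid Γ) b)) :
    Γ.Adj a b := by
  obtain ⟨hne, u, v, hu, hv, huv⟩ := h
  have hu' : closedNbhd Γ u = closedNbhd Γ a := Quotient.exact hu
  have hv' : closedNbhd Γ v = closedNbhd Γ b := Quotient.exact hv
  have hva : v ∈ closedNbhd Γ a := hu' ▸ Set.mem_insert_of_mem u huv
  have hav : a ∈ closedNbhd Γ v := hva.elim (fun h => h ▸ Set.mem_insert v _)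
    fun h => Set.mem_insert_of_mem v (Γ.symm.symm _ _ h)
  rw [hv'] at hav
  exact hav.elim (fun h => absurd (congrArg _ h) hne) fun h => Γ.symm.symm _ _ h

/-- A graph with an induced `2K₂` is not split. -/
theorem SimpleGraph.not_isSplit_univ {V : Type*} {Γ : SimpleGraph V} {a b c d : V}
    (hab : Γ.Adj a b) (hcd : Γ.Adj c d) (hac : ¬ Γ.Adj a c) (had : ¬ Γ.Adj a d)
    (hbc : ¬ Γ.Adj b c) (hbd : ¬ Γ.Adj b d) : ¬ Γ.IsSplit Set.univ := by
  rintro ⟨C, I, hCI, -, hC, hI⟩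
  have hedge {u v : V} (huv : Γ.Adj u v) : u ∈ C ∨ v ∈ C := by
    by_contra! h
    have hmem (w : V) (hw : w ∉ C) : w ∈ I :=
      (hCI ▸ Set.mem_univ w : w ∈ C ∪ I).resolve_left hw
    exact hI (hmem u h.1) (hmem v h.2) huv.ne huv
  have hcross {u v : V} (hu : u ∈ C) (hv : v ∈ C) (huv : ¬ Γ.Adj u v) : u = v :=
    by_contra fun hne => huv (hC hu hv hne)
  rcases hedge hab with ha | hb <;> rcases hedge hcd with hc | hd
  · exact had (hcross ha hc hac ▸ hcd)
  · exact hac (hcross ha hd had ▸ hcd.symm)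
  · exact hbd (hcross hb hc hbc ▸ hcd)
  · exact hbc (hcross hb hd hbd ▸ hcd.symm)

/-- An induced `2K₂` whose two edges join inequivalent vertices survives in the compact form. -/
theorem not_isSplit_compactForm_s19 {V : Type*} {Γ : SimpleGraph V} {a b c d : V}
    (hab : Γ.Adj a b) (hcd : Γ.Adj c d) (hac : ¬ Γ.Adj a c) (had : ¬ Γ.Adj a d)
    (hbc : ¬ Γ.Adj b c) (hbd : ¬ Γ.Adj b d) (hab' : closedNbhd Γ a ≠ closedNbhd Γ b)
    (hcd' : closedNbhd Γ c ≠ closedNbhd Γ d) : ¬ (compactForm Γ).IsSplit Set.univ :=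
  SimpleGraph.not_isSplit_univ (a := Quotient.mk _ a) (b := Quotient.mk _ b)
    (c := Quotient.mk _ c) (d := Quotient.mk _ d)
    ⟨fun h => hab' (Quotient.exact h), a, b, rfl, rfl, hab⟩
    ⟨fun h => hcd' (Quotient.exact h), c, d, rfl, rfl, hcd⟩
    (fun h => hac (compactForm_adj_mk h)) (fun h => had (compactForm_adj_mk h))
    (fun h => hbc (compactForm_adj_mk h)) (fun h => hbd (compactForm_adj_mk h))

/-- A group isomorphic to `GLₘ(2)` has no solvable subgroup of order divisible by `p * q`, provided
that its order is not divisible by `p ^ (i + 1)` or `q ^ (j + 1)`, that no smaller nontrivial power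
of one of the primes is `1` modulo the other, and that the fixed-space congruences for commuting
elements of orders `p` and `q` have no solution. -/
theorem not_exists_isSolvable_subgroup {G : Type*} [Group G] {m : ℕ}
    (e : G ≃* GL (Fin m) (ZMod 2)) {p q : ℕ} (hp : p.Prime) (hq : q.Prime) (hpq : p ≠ q) (i j : ℕ)
    (hi : ¬ p ^ (i + 1) ∣ ∏ k : Fin m, (2 ^ m - 2 ^ (k : ℕ)))
    (hj : ¬ q ^ (j + 1) ∣ ∏ k : Fin m, (2 ^ m - 2 ^ (k : ℕ)))
    (hpi : ∀ a ≤ i, a ≠ 0 → ¬ p ^ a ≡ 1 [MOD q]) (hqj : ∀ a ≤ j, a ≠ 0 → ¬ q ^ a ≡ 1 [MOD p])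
    (hdim : ∀ a < m, ∀ b < m, ∀ c ≤ a, ¬ (c ≤ b ∧ 2 ^ m ≡ 2 ^ a [MOD p] ∧
      2 ^ m ≡ 2 ^ b [MOD q] ∧ 2 ^ a ≡ 2 ^ c [MOD q] ∧ 2 ^ b ≡ 2 ^ c [MOD p])) :
    ¬ ∃ H : Subgroup G, Group.IsSolvable H ∧ p * q ∣ Nat.card H := by
  rintro ⟨H, hH, hdvd⟩
  have := Fact.mk hp
  have := Fact.mk hq
  have : Finite G := Finite.of_equiv _ e.symm.toEquiv
  have hcard : Nat.card G = ∏ k : Fin m, (2 ^ m - 2 ^ (k : ℕ)) := by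
    rw [Nat.card_congr e.toEquiv, Matrix.card_GL_field, ZMod.card]
  have hmod {r s l : ℕ} (hl : ¬ r ^ (l + 1) ∣ ∏ k : Fin m, (2 ^ m - 2 ^ (k : ℕ)))
      (h : ∀ a ≤ l, a ≠ 0 → ¬ r ^ a ≡ 1 [MOD s]) :
      ∀ a, a ≠ 0 → r ^ a ∣ Nat.card H → ¬ r ^ a ≡ 1 [MOD s] := by
    refine fun a ha had => h a (not_lt.mp fun hla => hl ?_) ha
    rw [← hcard]
    exact (pow_dvd_pow r hla).trans (had.trans H.card_subgroup_dvd_card)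
  obtain ⟨x, y, hx, hy, hxy⟩ := exists_commute_orderOf_of_isSolvable hp hq hpq
    (dvd_of_mul_right_dvd hdvd) (dvd_of_mul_left_dvd hdvd) (hmod hi hpi) (hmod hj hqj)
  let f : H →* LinearMap.GeneralLinearGroup (ZMod 2) (Fin m → ZMod 2) :=
    (e.trans Matrix.GeneralLinearGroup.toLin).toMonoidHom.comp H.subtype
  have hf : Function.Injective f :=
    (e.trans Matrix.GeneralLinearGroup.toLin).injective.comp H.subtype_injective
  obtain ⟨a, b, c, ha, hb, hca, hcb, hpa, hqb, hqc, hpc⟩ :=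
    exists_fixed_dimensions_of_commute ((orderOf_injective f hf x).trans hx)
      ((orderOf_injective f hf y).trans hy) (hxy.map f)
  rw [Module.finrank_fin_fun] at ha hb hpa hqb
  rw [Nat.card_zmod] at hpa hqb hqc hpc
  exact hdim a ha b hb c hca ⟨hcb, hpa, hqb, hqc, hpc⟩

/-- A group isomorphic to `GLₘ(2)` contains solvable subgroups of order `(2 ^ n - 1) * n` for
`1 ≤ n ≤ m`. -/
theorem exists_isSolvable_subgroup {G : Type*} [Group G] {m n r : ℕ}
    (e : G ≃* GL (Fin m) (ZMod 2)) (hn : n ≠ 0) (hnm : n ≤ m) (hr : r ∣ (2 ^ n - 1) * n) :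
    ∃ H : Subgroup G, Group.IsSolvable H ∧ r ∣ Nat.card H := by
  have hfin : Module.finrank (ZMod 2) (GaloisField 2 n) = n := GaloisField.finrank 2 hn
  obtain ⟨H, hH, hcard⟩ := exists_isSolvable_subgroup_generalLinearGroup (ZMod 2)
    (GaloisField 2 n) (Fin m → ZMod 2) (by rwa [hfin, Module.finrank_fin_fun])
  rw [hfin, GaloisField.card 2 n hn] at hcard
  let f := (e.trans Matrix.GeneralLinearGroup.toLin).symm.subgroupMap H
  refine ⟨_, Group.isSolvable_of_surjective (f := f.toMonoidHom) f.surjective, ?_⟩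
  rwa [← Nat.card_congr f.toEquiv, hcard]

/-- the compact form of the solvable graph of `PSL₁₁(2)` is not
split; in particular the solvable graph contains four primes inducing a
`2K₂` whose closed neighborhoods are pairwise distinct. -/
theorem compactForm_solvableGraph_psl11_2_not_split :
    ¬ (compactForm
        (solvableGraphOn (Matrix.ProjectiveSpecialLinearGroup (Fin 11) (ZMod 2)))).IsSplit
      Set.univ ∧
    ∃ a b c d : {r : ℕ // r.Prime ∧
        r ∣ Nat.card (Matrix.ProjectiveSpecialLinearGroup (Fin 11) (ZMod 2))},
      (solvableGraphOn (Matrix.ProjectiveSpecialLinearGroup (Fin 11) (ZMod 2))).Adj a b ∧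
      (solvableGraphOn (Matrix.ProjectiveSpecialLinearGroup (Fin 11) (ZMod 2))).Adj c d ∧
      ¬ (solvableGraphOn (Matrix.ProjectiveSpecialLinearGroup (Fin 11) (ZMod 2))).Adj a c ∧
      ¬ (solvableGraphOn (Matrix.ProjectiveSpecialLinearGroup (Fin 11) (ZMod 2))).Adj a d ∧
      ¬ (solvableGraphOn (Matrix.ProjectiveSpecialLinearGroup (Fin 11) (ZMod 2))).Adj b c ∧
      ¬ (solvableGraphOn (Matrix.ProjectiveSpecialLinearGroup (Fin 11) (ZMod 2))).Adj b d ∧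
      closedNbhd (solvableGraphOn (Matrix.ProjectiveSpecialLinearGroup (Fin 11) (ZMod 2))) a ≠
        closedNbhd (solvableGraphOn (Matrix.ProjectiveSpecialLinearGroup (Fin 11) (ZMod 2))) b ∧
      closedNbhd (solvableGraphOn (Matrix.ProjectiveSpecialLinearGroup (Fin 11) (ZMod 2))) a ≠
        closedNbhd (solvableGraphOn (Matrix.ProjectiveSpecialLinearGroup (Fin 11) (ZMod 2))) c ∧
      closedNbhd (solvableGraphOn (Matrix.ProjectiveSpecialLinearGroup (Fin 11) (ZMod 2))) a ≠
        closedNbhd (solvableGraphOn (Matrix.ProjectiveSpecialLinearGroup (Fin 11) (ZMod 2))) d ∧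
      closedNbhd (solvableGraphOn (Matrix.ProjectiveSpecialLinearGroup (Fin 11) (ZMod 2))) b ≠
        closedNbhd (solvableGraphOn (Matrix.ProjectiveSpecialLinearGroup (Fin 11) (ZMod 2))) c ∧
      closedNbhd (solvableGraphOn (Matrix.ProjectiveSpecialLinearGroup (Fin 11) (ZMod 2))) b ≠
        closedNbhd (solvableGraphOn (Matrix.ProjectiveSpecialLinearGroup (Fin 11) (ZMod 2))) d ∧
      closedNbhd (solvableGraphOn (Matrix.ProjectiveSpecialLinearGroup (Fin 11) (ZMod 2))) c ≠
        closedNbhd (solvableGraphOn (Matrix.ProjectiveSpecialLinearGroup (Fin 11) (ZMod 2))) d := by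
  obtain ⟨e⟩ := nonempty_mulEquiv_psl_generalLinearGroup 11
  have hvertex {n r : ℕ} (hn : n ≠ 0) (hnm : n ≤ 11) (hr : r ∣ (2 ^ n - 1) * n) :
      r ∣ Nat.card (Matrix.ProjectiveSpecialLinearGroup (Fin 11) (ZMod 2)) := by
    obtain ⟨H, -, hH⟩ := exists_isSolvable_subgroup e hn hnm hr
    exact hH.trans H.card_subgroup_dvd_card
  let vertex (r : ℕ) : Prop := r.Prime ∧
    r ∣ Nat.card (Matrix.ProjectiveSpecialLinearGroup (Fin 11) (ZMod 2))
  let Γ := solvableGraphOn (Matrix.ProjectiveSpecialLinearGroup (Fin 11) (ZMod 2))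
  have v7 : vertex 7 := ⟨by norm_num, hvertex (n := 3) (by decide) (by decide) (by decide)⟩
  have v11 : vertex 11 := ⟨by norm_num, hvertex (n := 11) (by decide) (by decide) (by decide)⟩
  have v23 : vertex 23 := ⟨by norm_num, hvertex (n := 11) (by decide) (by decide) (by decide)⟩
  have v31 : vertex 31 := ⟨by norm_num, hvertex (n := 5) (by decide) (by decide) (by decide)⟩
  have v73 : vertex 73 := ⟨by norm_num, hvertex (n := 9) (by decide) (by decide) (by decide)⟩
  have v127 : vertex 127 := ⟨by norm_num, hvertex (n := 7) (by decide) (by decide) (by decide)⟩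
  have hne {p q : ℕ} {hp : vertex p} {hq : vertex q} (h : p ≠ q) :
      (⟨p, hp⟩ : Subtype vertex) ≠ ⟨q, hq⟩ := fun hpq => h (congrArg Subtype.val hpq)
  have hadj {p q : ℕ} {hp : vertex p} {hq : vertex q} (n : ℕ) (h : p ≠ q) (hn : n ≠ 0)
      (hnm : n ≤ 11) (hdvd : p * q ∣ (2 ^ n - 1) * n) : Γ.Adj ⟨p, hp⟩ ⟨q, hq⟩ :=
    ⟨hne h, exists_isSolvable_subgroup e hn hnm hdvd⟩
  have hnadj {p q : ℕ} {hp : vertex p} {hq : vertex q} (i j : ℕ) (h : p ≠ q)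
      (hi : ¬ p ^ (i + 1) ∣ ∏ k : Fin 11, (2 ^ 11 - 2 ^ (k : ℕ)))
      (hj : ¬ q ^ (j + 1) ∣ ∏ k : Fin 11, (2 ^ 11 - 2 ^ (k : ℕ)))
      (hpi : ∀ a ≤ i, a ≠ 0 → ¬ p ^ a ≡ 1 [MOD q])
      (hqj : ∀ a ≤ j, a ≠ 0 → ¬ q ^ a ≡ 1 [MOD p])
      (hdim : ∀ a < 11, ∀ b < 11, ∀ c ≤ a, ¬ (c ≤ b ∧ 2 ^ 11 ≡ 2 ^ a [MOD p] ∧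
        2 ^ 11 ≡ 2 ^ b [MOD q] ∧ 2 ^ a ≡ 2 ^ c [MOD q] ∧ 2 ^ b ≡ 2 ^ c [MOD p])) :
      ¬ Γ.Adj ⟨p, hp⟩ ⟨q, hq⟩ := fun hpq =>
    not_exists_isSolvable_subgroup e hp.1 hq.1 h i j hi hj hpi hqj hdim hpq.2
  have h11_23 : Γ.Adj ⟨11, v11⟩ ⟨23, v23⟩ := hadj 11 (by decide) (by decide) (by decide) (by decide)
  have h127_7 : Γ.Adj ⟨127, v127⟩ ⟨7, v7⟩ := hadj 7 (by decide) (by decide) (by decide) (by decide)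
  have h11_31 : Γ.Adj ⟨11, v11⟩ ⟨31, v31⟩ := hadj 10 (by decide) (by decide) (by decide) (by decide)
  have h7_73 : Γ.Adj ⟨7, v7⟩ ⟨73, v73⟩ := hadj 9 (by decide) (by decide) (by decide) (by decide)
  have h11_127 : ¬ Γ.Adj ⟨11, v11⟩ ⟨127, v127⟩ :=
    hnadj 1 1 (by decide) (by decide +kernel) (by decide +kernel) (by decide +kernel)
      (by decide +kernel) (by decide +kernel)
  have h11_7 : ¬ Γ.Adj ⟨11, v11⟩ ⟨7, v7⟩ :=
    hnadj 1 3 (by decide) (by decide +kernel) (by decide +kernel) (by decide +kernel)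
      (by decide +kernel) (by decide +kernel)
  have h23_127 : ¬ Γ.Adj ⟨23, v23⟩ ⟨127, v127⟩ :=
    hnadj 1 1 (by decide) (by decide +kernel) (by decide +kernel) (by decide +kernel)
      (by decide +kernel) (by decide +kernel)
  have h23_7 : ¬ Γ.Adj ⟨23, v23⟩ ⟨7, v7⟩ :=
    hnadj 1 3 (by decide) (by decide +kernel) (by decide +kernel) (by decide +kernel)
      (by decide +kernel) (by decide +kernel)
  have h23_31 : ¬ Γ.Adj ⟨23, v23⟩ ⟨31, v31⟩ :=
    hnadj 1 2 (by decide) (by decide +kernel) (by decide +kernel) (by decide +kernel)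
      (by decide +kernel) (by decide +kernel)
  have h127_73 : ¬ Γ.Adj ⟨127, v127⟩ ⟨73, v73⟩ :=
    hnadj 1 1 (by decide) (by decide +kernel) (by decide +kernel) (by decide +kernel)
      (by decide +kernel) (by decide +kernel)
  have hN_11_23 : closedNbhd Γ ⟨11, v11⟩ ≠ closedNbhd Γ ⟨23, v23⟩ :=
    closedNbhd_ne_of_adj h11_31 (hne (by decide)) h23_31
  have hN_127_7 : closedNbhd Γ ⟨127, v127⟩ ≠ closedNbhd Γ ⟨7, v7⟩ :=
    (closedNbhd_ne_of_adj h7_73 (hne (by decide)) h127_73).symm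
  exact ⟨not_isSplit_compactForm_s19 h11_23 h127_7 h11_127 h11_7 h23_127 h23_7 hN_11_23 hN_127_7,
    ⟨11, v11⟩, ⟨23, v23⟩, ⟨127, v127⟩, ⟨7, v7⟩, h11_23, h127_7, h11_127, h11_7, h23_127, h23_7, hN_11_23,
    closedNbhd_ne_of_not_adj (hne (by decide)) h11_127,
    closedNbhd_ne_of_not_adj (hne (by decide)) h11_7,
    closedNbhd_ne_of_not_adj (hne (by decide)) h23_127,
    closedNbhd_ne_of_not_adj (hne (by decide)) h23_7, hN_127_7⟩
end
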